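/- arXiv:2311.05254 — 3 statements merged into one kernel-verified Lean document; each statement's English description precedes it below -/
import Mathlib

section
/- Let g be a nonconstant entire function with g(0) = 1, let n(r) denote the number of zeros of g in |z| ≤ r counted with multiplicity, and let m > 1. Then there exist a constant C > 0 and a set E ⊂ (1,∞) of finite logarithmic measure such that n(r) ≤ C · L(r,∞,g) · log^m L(r,∞,g) for all r ∉ [0,1] ∪ E. -/
open MeasureTheory Filter Metric

noncomputable section

/-- `log⁺ x = max (log x) 0`. -/
def logPlus (x : ℝ) : ℝ := max (Real.log x) 0

/-- The point `r·e^{iθ}` on the circle of radius `r`. -/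
def circlePt (r θ : ℝ) : ℂ := (r : ℂ) * Complex.exp (θ * Complex.I)

/-- Maximum modulus `M(r,g)`. -/
def maxMod (g : ℂ → ℂ) (r : ℝ) : ℝ := sSup ((fun z => ‖g z‖) '' sphere (0:ℂ) r)

/-- `L(r,a,f) = max_{|z|=r} log⁺ (1/|f z − a|)`. -/
def Lfin (f : ℂ → ℂ) (a : ℂ) (r : ℝ) : ℝ :=
  sSup ((fun z => logPlus (1 / ‖f z - a‖)) '' sphere (0:ℂ) r)

/-- `L(r,∞,f) = max_{|z|=r} log⁺ |f z|`. -/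
def Linf (f : ℂ → ℂ) (r : ℝ) : ℝ :=
  sSup ((fun z => logPlus ‖f z‖) '' sphere (0:ℂ) r)

/-- Nevanlinna proximity function `m(r,a,f)`. -/
def proximity (f : ℂ → ℂ) (a : ℂ) (r : ℝ) : ℝ :=
  (1 / (2 * Real.pi)) * ∫ θ in (0:ℝ)..(2 * Real.pi), logPlus (1 / ‖f (circlePt r θ) - a‖)

/-- Spherical derivative `f#`. -/
def sphDeriv (f : ℂ → ℂ) (z : ℂ) : ℝ := ‖deriv f z‖ / (1 + ‖f z‖ ^ 2)

/-- `A(r,f)`, the normalized spherical area of the image of `D(0,r)`. -/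
def sphArea (f : ℂ → ℂ) (r : ℝ) : ℝ :=
  (1 / Real.pi) * ∫ z in ball (0:ℂ) r, sphDeriv f z ^ 2

/-- Ahlfors–Shimizu characteristic `T₀(r,f)`. -/
def T0 (f : ℂ → ℂ) (r : ℝ) : ℝ := ∫ t in (0:ℝ)..r, sphArea f t / t

/-- The Nevanlinna characteristic `T(r,f)`; we use the Ahlfors–Shimizu characteristic,
which agrees with the classical Nevanlinna characteristic up to a bounded term. -/
def nevT (f : ℂ → ℂ) (r : ℝ) : ℝ := T0 f r

/-- Petrenko's magnitude of deviation `δ_P(a,f)`. -/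
def deltaP (f : ℂ → ℂ) (a : ℂ) : ℝ := liminf (fun r => Lfin f a r / nevT f r) atTop

/-- Nevanlinna deficiency `δ_N(a,f)`. -/
def deltaN (f : ℂ → ℂ) (a : ℂ) : ℝ := liminf (fun r => proximity f a r / nevT f r) atTop

/-- Eremenko deviation `δ_E(a,f)`. -/
def deltaE (f : ℂ → ℂ) (a : ℂ) : ℝ := liminf (fun r => Lfin f a r / sphArea f r) atTop

/-- Order of growth `ρ(f)` (as an extended real, via the characteristic). -/
def fnOrder (f : ℂ → ℂ) : EReal :=
  limsup (fun r => ((Real.log (nevT f r) / Real.log r : ℝ) : EReal)) atTop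

/-- Logarithmic order `ρ_log(f)`. -/
def fnLogOrder (f : ℂ → ℂ) : EReal :=
  limsup (fun r => ((Real.log (nevT f r) / Real.log (Real.log r) : ℝ) : EReal)) atTop

/-- Upper linear density of `E ⊆ [0,∞)`. -/
def upDens (E : Set ℝ) : ℝ :=
  limsup (fun r => (volume (E ∩ Set.Icc 0 r)).toReal / r) atTop

/-- Upper logarithmic density of `E ⊆ [1,∞)`. -/
def upLogDens (E : Set ℝ) : ℝ :=
  limsup (fun r => (∫ t in E ∩ Set.Icc 1 r, 1 / t) / Real.log r) atTop

/-- Finite linear (Lebesgue) measure. -/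
def FiniteLinearMeasure (E : Set ℝ) : Prop := volume E < ⊤

/-- Finite logarithmic measure: `∫_E dt/t < ∞`. -/
def FiniteLogMeasure (E : Set ℝ) : Prop := ∫⁻ t in E, ENNReal.ofReal (1 / t) < ⊤

/-- `g` is (the function of) a polynomial. -/
def IsPolyFn (g : ℂ → ℂ) : Prop := ∃ p : Polynomial ℂ, ∀ z, g z = p.eval z

/-- `g` is a rational function. -/
def IsRatFn (g : ℂ → ℂ) : Prop :=
  ∃ p q : Polynomial ℂ, q ≠ 0 ∧ ∀ z, q.eval z ≠ 0 → g z = p.eval z / q.eval z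

/-- Transcendental entire function. -/
def TranscEntire (g : ℂ → ℂ) : Prop := Differentiable ℂ g ∧ ¬ IsPolyFn g

/-- Transcendental meromorphic function on ℂ. -/
def TranscMero (g : ℂ → ℂ) : Prop := MeromorphicOn g Set.univ ∧ ¬ IsRatFn g

/-- Entire solution of `f⁽ⁿ⁾ + A_{n-1} f⁽ⁿ⁻¹⁾ + ⋯ + A₀ f = 0`. -/
def IsSolutionE (n : ℕ) (A : Fin n → ℂ → ℂ) (f : ℂ → ℂ) : Prop :=
  Differentiable ℂ f ∧
  ∀ z, iteratedDeriv n f z + ∑ j : Fin n, A j z * iteratedDeriv j f z = 0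

/-- Meromorphic solution of the equation (the identity is required at every point where
all functions involved are analytic, which determines it as an identity of meromorphic
functions). -/
def IsSolutionM (n : ℕ) (A : Fin n → ℂ → ℂ) (f : ℂ → ℂ) : Prop :=
  MeromorphicOn f Set.univ ∧
  ∀ z, AnalyticAt ℂ f z → (∀ j, AnalyticAt ℂ (A j) z) →
    iteratedDeriv n f z + ∑ j : Fin n, A j z * iteratedDeriv j f z = 0

/-- A solution base of the equation with entire coefficients. -/
def IsSolutionBase (n : ℕ) (A : Fin n → ℂ → ℂ) (F : Fin n → ℂ → ℂ) : Prop :=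
  (∀ k, IsSolutionE n A (F k)) ∧ LinearIndependent ℂ F ∧
  ∀ g, IsSolutionE n A g → ∃ c : Fin n → ℂ, g = fun z => ∑ k : Fin n, c k * F k z

/-- The characteristic function `T(r)` of the equation attached to a solution base. -/
def charFn (n : ℕ) (F : Fin n → ℂ → ℂ) (r : ℝ) : ℝ :=
  (1 / (2 * Real.pi)) * ∫ θ in (0:ℝ)..(2 * Real.pi),
    Real.log (Real.sqrt (1 + ∑ k : Fin n, ‖F k (circlePt r θ)‖ ^ 2))

/-- Multiplicity of `z` as a zero of `g` (smallest `k` with `g⁽ᵏ⁾(z) ≠ 0`). -/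
def zeroMult (g : ℂ → ℂ) (z : ℂ) : ℕ := sInf {k : ℕ | iteratedDeriv k g z ≠ 0}

/-- Number of zeros of `g` in `|z| ≤ r`, counted with multiplicity. -/
def zeroCount (g : ℂ → ℂ) (r : ℝ) : ℕ := ∑ᶠ z ∈ closedBall (0:ℂ) r, zeroMult g z

end

/-- The smallest order of a nonvanishing derivative is the order of vanishing. -/
lemma zeroMult_eq_analyticOrderNatAt {g : ℂ → ℂ} {z : ℂ} (hg : AnalyticAt ℂ g z) :
    zeroMult g z = analyticOrderNatAt g z := by
  unfold zeroMult analyticOrderNatAt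
  cases h : analyticOrderAt g z with
  | top =>
    have hz : ∀ k, iteratedDeriv k g z = 0 := fun k =>
      (natCast_le_analyticOrderAt_iff_iteratedDeriv_eq_zero (n := k + 1) hg).1 (by simp [h]) k
        (by omega)
    simp [hz]
  | coe n =>
    obtain ⟨h1, h2⟩ := (analyticOrderAt_eq_nat_iff_iteratedDeriv_eq_zero hg).1 h
    apply le_antisymm
    · exact Nat.sInf_le h2
    · refine le_csInf ⟨n, h2⟩ fun k hk => ?_
      by_contra! hlt
      exact hk (h1 k hlt)

lemma zeroCount_eq_finsum_divisor {g : ℂ → ℂ} (hg : Differentiable ℂ g) (r : ℝ) :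
    (zeroCount g r : ℤ) = ∑ᶠ z, MeromorphicOn.divisor g (closedBall 0 r) z := by
  have han : AnalyticOnNhd ℂ g (closedBall 0 r) := fun z _ => hg.analyticAt z
  unfold zeroCount
  have hcast : ((∑ᶠ z ∈ closedBall (0:ℂ) r, zeroMult g z : ℕ) : ℤ)
      = ∑ᶠ z, ((∑ᶠ _ : z ∈ closedBall (0:ℂ) r, zeroMult g z : ℕ) : ℤ) :=
    (Nat.castAddMonoidHom ℤ).map_finsum_of_injective Nat.cast_injective _
  rw [hcast]
  refine finsum_congr fun z => ?_
  classical
  by_cases hz : z ∈ closedBall (0:ℂ) r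
  · rw [finsum_eq_if, if_pos hz, MeromorphicOn.AnalyticOnNhd.divisor_apply han hz,
      zeroMult_eq_analyticOrderNatAt (han z hz), analyticOrderNatAt]
    cases analyticOrderAt g z <;> simp
  · rw [finsum_eq_if, if_neg hz, Function.locallyFinsuppWithin.apply_eq_zero_of_notMem _ hz]
    rfl

lemma logPlus_norm_le_Linf {g : ℂ → ℂ} (hg : Continuous g) {r : ℝ} {z : ℂ}
    (hz : z ∈ sphere (0:ℂ) r) : logPlus ‖g z‖ ≤ Linf g r := by
  have hc : Continuous fun z => logPlus ‖g z‖ := by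
    have : (fun z => logPlus ‖g z‖) = fun z => Real.posLog ‖g z‖ := by
      funext z
      rw [logPlus, Real.posLog_apply, max_comm]
    rw [this]
    exact Real.continuous_posLog.comp hg.norm
  exact le_csSup ((isCompact_sphere (0:ℂ) r).image hc).bddAbove ⟨z, hz, rfl⟩

lemma norm_le_exp_logPlus (x : ℝ) (hx : 0 ≤ x) : x ≤ Real.exp (logPlus x) := by
  rcases hx.eq_or_lt with rfl | h
  · positivity
  · exact (Real.log_le_iff_le_exp h).1 (le_max_left _ _)

lemma Linf_nonneg (g : ℂ → ℂ) (r : ℝ) : 0 ≤ Linf g r := by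
  apply Real.sSup_nonneg
  rintro _ ⟨z, -, rfl⟩
  exact le_max_right _ _

/-- The maximum modulus principle, in terms of `Linf`. -/
lemma norm_le_exp_Linf {g : ℂ → ℂ} (hg : Differentiable ℂ g) {r : ℝ} (hr : 0 < r) {z : ℂ}
    (hz : z ∈ closedBall (0:ℂ) r) : ‖g z‖ ≤ Real.exp (Linf g r) := by
  refine Complex.norm_le_of_forall_mem_frontier_norm_le (U := ball (0:ℂ) r) isBounded_ball
    hg.diffContOnCl ?_ (by rwa [closure_ball _ hr.ne'])
  intro w hw
  rw [frontier_ball _ hr.ne'] at hw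
  exact (norm_le_exp_logPlus _ (norm_nonneg _)).trans
    (Real.exp_le_exp.2 (logPlus_norm_le_Linf hg.continuous hw))

lemma Linf_mono {g : ℂ → ℂ} (hg : Differentiable ℂ g) {r R : ℝ} (hr : 0 < r) (hrR : r ≤ R) :
    Linf g r ≤ Linf g R := by
  refine Real.sSup_le ?_ (Linf_nonneg g R)
  rintro _ ⟨z, hz, rfl⟩
  refine max_le ?_ (Linf_nonneg g R)
  have h := norm_le_exp_Linf hg (hr.trans_le hrR)
    (closedBall_subset_closedBall hrR (sphere_subset_closedBall hz))
  rcases (norm_nonneg (g z)).eq_or_lt with h0 | h0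
  · simp [← h0, Linf_nonneg]
  · exact (Real.log_le_iff_le_exp h0).2 h

/-- Liouville's theorem, in terms of `Linf`. -/
lemma exists_lt_Linf {g : ℂ → ℂ} (hg : Differentiable ℂ g) (hgc : ¬ ∃ c : ℂ, ∀ z, g z = c)
    (B : ℝ) : ∃ r, 1 ≤ r ∧ B < Linf g r := by
  by_contra! h
  apply hgc
  refine hg.exists_const_forall_eq_of_bounded ?_
  refine (isBounded_iff_forall_norm_le).2 ⟨Real.exp B, ?_⟩
  rintro _ ⟨z, rfl⟩
  have h1 : 1 ≤ ‖z‖ + 1 := by linarith [norm_nonneg z]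
  exact (norm_le_exp_Linf hg (r := ‖z‖ + 1) (by linarith) (by simp)).trans
    (Real.exp_le_exp.2 (h _ h1))

/-- Jensen's bound for the number of zeros of an entire function with `g 0 = 1`. -/
lemma zeroCount_le {g : ℂ → ℂ} (hg : Differentiable ℂ g) (h0 : g 0 = 1) {r h : ℝ} (hr : 0 < r)
    (hh : 0 < h) : (zeroCount g r : ℝ) ≤ Linf g (r * (1 + h)) * (1 + 1 / h) := by
  have hrR : r < r * (1 + h) := by nlinarith
  have hR : 0 < r * (1 + h) := hr.trans hrR
  have key := AnalyticOnNhd.sum_divisor_le (c := 0) (r := r) (R := r * (1 + h))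
    (M := Real.exp (Linf g (r * (1 + h)))) (f := g) (abs_pos.2 hr.ne')
    (by rwa [abs_of_pos hr, abs_of_pos hR]) (Real.one_le_exp (Linf_nonneg _ _))
    (fun z _ => hg.analyticAt z) (by simp [h0]) (fun z hz => norm_le_exp_Linf hg hR
      (sphere_subset_closedBall (by rwa [abs_of_pos hR] at hz)))
  rw [abs_of_pos hr, ← zeroCount_eq_finsum_divisor hg, h0, norm_one, div_one, Real.log_exp,
    mul_div_cancel_left₀ _ hr.ne', Int.cast_natCast] at key
  refine key.trans ?_
  rw [div_eq_mul_inv]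
  refine mul_le_mul_of_nonneg_left ?_ (Linf_nonneg _ _)
  have hlog := Real.one_sub_inv_le_log_of_pos (x := 1 + h) (by linarith)
  have e : 1 - (1 + h)⁻¹ = (1 + 1 / h)⁻¹ := by field_simp; ring
  rw [e] at hlog
  exact inv_le_of_inv_le₀ (by positivity) hlog

/-- A set in which any two points have ratio at most `1 + h` has logarithmic measure at
most `h`. -/
lemma lintegral_one_div_le {S : Set ℝ} {h : ℝ} (hS : ∀ x ∈ S, 0 < x) (hh : 0 ≤ h)
    (hd : ∀ x ∈ S, ∀ y ∈ S, y ≤ x * (1 + h)) :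
    ∫⁻ t in S, ENNReal.ofReal (1 / t) ≤ ENNReal.ofReal h := by
  rcases S.eq_empty_or_nonempty with rfl | ⟨a, ha⟩
  · simp
  have hbd : BddAbove S := ⟨a * (1 + h), fun y hy => hd a ha y hy⟩
  have hs : 0 < sSup S := (hS a ha).trans_le (le_csSup hbd ha)
  have h1 : 0 < 1 + h := by linarith
  have hsub : S ⊆ Set.Icc (sSup S / (1 + h)) (sSup S) := fun x hx =>
    ⟨(div_le_iff₀ h1).2 (csSup_le ⟨a, ha⟩ fun y hy => hd x hx y hy), le_csSup hbd hx⟩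
  calc ∫⁻ t in S, ENNReal.ofReal (1 / t)
      ≤ ∫⁻ t in Set.Icc (sSup S / (1 + h)) (sSup S), ENNReal.ofReal (1 / t) :=
        lintegral_mono_set hsub
    _ ≤ ∫⁻ _ in Set.Icc (sSup S / (1 + h)) (sSup S), ENNReal.ofReal ((1 + h) / sSup S) := by
        refine setLIntegral_mono measurable_const fun t ht => ENNReal.ofReal_le_ofReal ?_
        rw [← one_div_div (sSup S)]
        exact one_div_le_one_div_of_le (by positivity) ht.1
    _ = ENNReal.ofReal h := by
        rw [setLIntegral_const, Real.volume_Icc, ← ENNReal.ofReal_mul (by positivity)]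
        congr 1
        field_simp
        ring

/-- A Borel-type growth lemma: a function nondecreasing and at least `2` on `[r₀, ∞)` at most
doubles when `r` is replaced by `r * (1 + h (u r))`, outside a set of finite logarithmic
measure. -/
lemma exists_finiteLogMeasure_le_two_mul {u h : ℝ → ℝ} {r₀ : ℝ} (hr₀ : 1 ≤ r₀)
    (hu : MonotoneOn u (Set.Ici r₀)) (hu2 : 2 ≤ u r₀) (hpos : ∀ t, 2 ≤ t → 0 < h t)
    (hanti : AntitoneOn h (Set.Ici 2)) (hsum : Summable fun k : ℕ => h (2 ^ (k + 1))) :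
    ∃ E : Set ℝ, E ⊆ Set.Ioi 1 ∧ FiniteLogMeasure E ∧ Set.Ioc 1 r₀ ⊆ E ∧
      ∀ r, r₀ < r → r ∉ E → u (r * (1 + h (u r))) ≤ 2 * u r := by
  let B : ℕ → Set ℝ := fun k => {r | r₀ < r ∧ 2 ^ (k + 1) ≤ u r ∧ u r < 2 ^ (k + 2) ∧
    2 * u r < u (r * (1 + h (u r)))}
  have h2k : ∀ k : ℕ, (2:ℝ) ≤ 2 ^ (k + 1) := fun k => le_self_pow₀ one_le_two (by omega)
  have hB : ∀ k, ∫⁻ t in B k, ENNReal.ofReal (1 / t) ≤ ENNReal.ofReal (h (2 ^ (k + 1))) := by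
    intro k
    refine lintegral_one_div_le (fun x hx => by linarith [hx.1]) (hpos _ (h2k k)).le ?_
    rintro x ⟨hx0, hx1, hx2, hx3⟩ y ⟨hy0, hy1, hy2, hy3⟩
    by_contra! hlt
    have hle : h (u x) ≤ h (2 ^ (k + 1)) := hanti (h2k k) ((h2k k).trans hx1) hx1
    have hp := hpos (u x) ((h2k k).trans hx1)
    have hx : 0 < x := by linarith
    have hm : x * (1 + h (u x)) ≤ y := le_trans (by gcongr) hlt.le
    have hm' : r₀ ≤ x * (1 + h (u x)) := by nlinarith
    have := hu hm' (hm'.trans hm) hm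
    rw [pow_succ] at hy2
    linarith
  refine ⟨Set.Ioc 1 r₀ ∪ ⋃ k, B k, ?_, ?_, Set.subset_union_left, ?_⟩
  · rintro x (hx | hx)
    · exact hx.1
    · obtain ⟨k, hk⟩ := Set.mem_iUnion.1 hx
      exact hr₀.trans_lt hk.1
  · refine (lintegral_union_le _ _ _).trans_lt (ENNReal.add_lt_top.2 ⟨?_, ?_⟩)
    · refine (lintegral_one_div_le (h := r₀) (fun x hx => by linarith [hx.1]) (by linarith)
        ?_).trans_lt ENNReal.ofReal_lt_top
      intro x hx y hy
      nlinarith [hx.1, hy.2]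
    · refine (lintegral_iUnion_le _ _).trans_lt ((ENNReal.tsum_le_tsum hB).trans_lt ?_)
      rw [← ENNReal.ofReal_tsum_of_nonneg (fun k => (hpos _ (h2k k)).le) hsum]
      exact ENNReal.ofReal_lt_top
  · intro r hr hrE
    by_contra! hlt
    have hur : 2 ≤ u r := hu2.trans (hu Set.self_mem_Ici hr.le hr.le)
    obtain ⟨n, hn1, hn2⟩ := exists_nat_pow_near (x := u r) (by linarith) one_lt_two
    rcases n with _ | k
    · norm_num at hn2
      linarith
    · exact hrE (Or.inr (Set.mem_iUnion.2 ⟨k, hr, hn1, hn2, hlt⟩))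

/-- Lemma 4.2: for a nonconstant entire `g` with `g(0) = 1` and `m > 1`,
`n(r) ≲ L(r,∞,g) · logᵐ L(r,∞,g)` for all `r ∉ [0,1] ∪ E`, where `E ⊂ (1,∞)` has finite
logarithmic measure. -/
theorem zero_count_upper_bound
    (g : ℂ → ℂ) (hg : Differentiable ℂ g) (hgc : ¬ ∃ c : ℂ, ∀ z, g z = c)
    (h0 : g 0 = 1) (m : ℝ) (hm : 1 < m) :
    ∃ C : ℝ, 0 < C ∧ ∃ E : Set ℝ, E ⊆ Set.Ioi 1 ∧ FiniteLogMeasure E ∧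
      ∀ r : ℝ, r ∉ Set.Icc (0:ℝ) 1 ∪ E →
        (zeroCount g r : ℝ) ≤ C * Linf g r * Real.log (Linf g r) ^ m := by
  obtain ⟨r₀, hr₀, hL⟩ := exists_lt_Linf hg hgc 2
  have hlog2 : 0 < Real.log 2 := Real.log_pos one_lt_two
  have hlog : ∀ t : ℝ, 2 ≤ t → Real.log 2 ≤ Real.log t := fun t ht =>
    Real.log_le_log two_pos ht
  obtain ⟨E, hE1, hE2, hE3, hE4⟩ := exists_finiteLogMeasure_le_two_mul (u := Linf g)
    (h := fun t => 1 / Real.log t ^ m) hr₀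
    (fun x hx y _ hxy => Linf_mono hg (by linarith [Set.mem_Ici.1 hx]) hxy) hL.le
    (fun t ht => by
      have := hlog2.trans_le (hlog t ht)
      positivity)
    (fun s hs t ht hst => by
      have := hlog2.trans_le (hlog s hs)
      have hs0 : (0:ℝ) < s := by linarith [Set.mem_Ici.1 hs]
      dsimp only
      gcongr)
    (by
      have hs : Summable fun k : ℕ => 1 / (((k + 1 : ℕ) : ℝ)) ^ m :=
        (summable_nat_add_iff 1).2 (Real.summable_one_div_nat_rpow.2 hm)
      refine (hs.mul_right (1 / Real.log 2 ^ m)).congr fun k => ?_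
      rw [Real.log_pow, Real.mul_rpow (by positivity) hlog2.le]
      field_simp)
  refine ⟨2 * (1 + 1 / Real.log 2 ^ m), by positivity, E, hE1, hE2, fun r hr => ?_⟩
  rw [Set.mem_union, not_or] at hr
  rcases lt_or_ge r 0 with hneg | hnn
  · simp [zeroCount, Linf, closedBall_eq_empty.2 hneg, sphere_eq_empty_of_neg hneg]
  have hr1 : 1 < r := by
    by_contra! h
    exact hr.1 ⟨hnn, h⟩
  have hr2 : r₀ < r := by
    by_contra! h
    exact hr.2 (hE3 ⟨hr1, h⟩)
  have hLr : 2 ≤ Linf g r := hL.le.trans (Linf_mono hg (by linarith) hr2.le)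
  have hlr := hlog _ hLr
  have hp : 0 < Real.log (Linf g r) ^ m := Real.rpow_pos_of_pos (hlog2.trans_le hlr) m
  have hp2 : 0 < Real.log 2 ^ m := Real.rpow_pos_of_pos hlog2 m
  have hpp : Real.log 2 ^ m ≤ Real.log (Linf g r) ^ m := by gcongr
  have hbound := zeroCount_le hg h0 (r := r) (h := 1 / Real.log (Linf g r) ^ m) (by linarith)
    (by positivity)
  rw [one_div_one_div] at hbound
  have hone : 1 ≤ 1 / Real.log 2 ^ m * Real.log (Linf g r) ^ m := by
    rw [one_div_mul_eq_div]
    exact (one_le_div hp2).2 hpp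
  calc (zeroCount g r : ℝ)
      ≤ Linf g (r * (1 + 1 / Real.log (Linf g r) ^ m)) * (1 + Real.log (Linf g r) ^ m) := hbound
    _ ≤ 2 * Linf g r * (1 / Real.log 2 ^ m * Real.log (Linf g r) ^ m
          + Real.log (Linf g r) ^ m) := by
        have := hE4 r hr2 hr.2
        gcongr
    _ = 2 * (1 + 1 / Real.log 2 ^ m) * Linf g r * Real.log (Linf g r) ^ m := by ring
end

section
/- Suppose the coefficients A₀,…,A_{n−1} of (*) are entire, let {f₁,…,f_n} be a solution base of (*), and let T(r) be the associated characteristic function of (*). Then there exists a set E ⊂ [0,∞) of finite linear measure such that L(r,∞,A_j) = O(log r + log T(r)) for r ∉ E and every j = 0,…,n−1. -/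
open MeasureTheory Filter Metric

lemma norm_logDeriv_le_of_forall_ne_zero {g : ℂ → ℂ} {R M m A ε : ℝ} {z : ℂ}
    (hg : DifferentiableOn ℂ g (ball 0 R)) (hne : ∀ w ∈ ball (0 : ℂ) R, g w ≠ 0)
    (hM : ∀ w ∈ ball (0 : ℂ) R, ‖g w‖ ≤ M) (hm : 0 < m) (hm0 : m ≤ ‖g 0‖)
    (hA : Real.log (M / m) + 1 ≤ A) (hε : 0 < ε) (hz : ‖z‖ + 2 * ε ≤ R) :
    ‖deriv g z / g z‖ ≤ 2 * A * R / ε ^ 2 := by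
  have hz0 := norm_nonneg z
  have hR : 0 < R := by linarith
  have h0 : (0 : ℂ) ∈ ball (0 : ℂ) R := by simpa using hR
  have hmM : m ≤ M := hm0.trans (hM 0 h0)
  have hlog : 0 ≤ Real.log (M / m) := Real.log_nonneg (by rwa [one_le_div hm])
  have hA0 : 0 < A := by linarith
  have hdg : DifferentiableOn ℂ (fun w => deriv g w / g w) (ball 0 R) :=
    (hg.deriv isOpen_ball).div hg hne
  obtain ⟨h, hh0, hh⟩ := (hdg.isExactOn_ball).with_val_at 0 0
  have hhd : DifferentiableOn ℂ h (ball 0 R) := fun w hw =>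
    (hh w hw).differentiableAt.differentiableWithinAt
  have hgd : ∀ w ∈ ball (0 : ℂ) R, HasDerivAt g (deriv g w) w := fun w hw =>
    (hg.differentiableAt (isOpen_ball.mem_nhds hw)).hasDerivAt
  have key : ∀ w ∈ ball (0 : ℂ) R, Complex.exp (-h w) * g w = g 0 := by
    intro w hw
    have hd : ∀ v ∈ ball (0 : ℂ) R, HasDerivAt (fun v => Complex.exp (-h v) * g v) 0 v := by
      intro v hv
      have := ((hh v hv).neg.cexp).mul (hgd v hv)
      refine this.congr_deriv ?_
      have := hne v hv
      rw [mul_assoc, neg_mul, div_mul_cancel₀ _ this]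
      ring
    have := (convex_ball (0 : ℂ) R).is_const_of_fderivWithin_eq_zero (𝕜 := ℂ)
      (f := fun v => Complex.exp (-h v) * g v)
      (fun v hv => (hd v hv).differentiableAt.differentiableWithinAt)
      (fun v hv => by
        rw [fderivWithin_of_isOpen isOpen_ball hv]
        ext; simp [(hd v hv).deriv]) hw h0
    simpa [hh0] using this
  have hre : Set.MapsTo h (ball 0 R) {v | v.re ≤ A} := by
    intro w hw
    have h1 := key w hw
    have hg0 : 0 < ‖g 0‖ := hm.trans_le hm0
    have h2 : Real.exp (-(h w).re) * ‖g w‖ = ‖g 0‖ := by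
      rw [← h1, norm_mul, Complex.norm_exp]; simp
    have h3 : ‖g w‖ = ‖g 0‖ * Real.exp (h w).re := by
      rw [← h2, Real.exp_neg]; field_simp
    have h4 : Real.exp (h w).re ≤ M / m := by
      rw [le_div_iff₀ hm]
      calc _ ≤ Real.exp (h w).re * ‖g 0‖ := by gcongr
        _ = ‖g w‖ := by rw [h3]; ring
        _ ≤ M := hM w hw
    have := (Real.le_log_iff_exp_le (div_pos (hm.trans_le hmM) hm)).2 h4
    show (h w).re ≤ A
    linarith
  have hbc : ∀ w ∈ sphere z ε, ‖h w‖ ≤ 2 * A * R / ε := by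
    intro w hw
    have hwz : ‖w‖ ≤ ‖z‖ + ε := by
      have : ‖w - z‖ = ε := by simpa [dist_eq_norm] using hw
      calc ‖w‖ = ‖z + (w - z)‖ := by ring_nf
        _ ≤ _ := by rw [← this]; exact norm_add_le _ _
    have := Complex.borelCaratheodory_zero hA0 hhd hre hR (z := w)
      (by rw [mem_ball_zero_iff]; linarith) hh0
    refine this.trans ?_
    gcongr <;> linarith
  have hsub : closedBall z ε ⊆ ball 0 R := by
    intro w hw
    rw [mem_closedBall, dist_eq_norm] at hw
    rw [mem_ball_zero_iff]
    calc ‖w‖ = ‖z + (w - z)‖ := by ring_nf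
        _ ≤ ‖z‖ + ‖w - z‖ := norm_add_le _ _
        _ < R := by linarith
  have hdc : DiffContOnCl ℂ h (ball z ε) := by
    apply DifferentiableOn.diffContOnCl
    rw [closure_ball z hε.ne']
    exact hhd.mono hsub
  have := Complex.norm_deriv_le_of_forall_mem_sphere_norm_le hε hdc hbc
  rw [(hh z (by rw [mem_ball_zero_iff]; linarith)).deriv] at this
  refine this.trans (le_of_eq ?_)
  field_simp

lemma norm_le_of_forall_sphere {f : ℂ → ℂ} {R M : ℝ} (hR : 0 < R) (hf : Differentiable ℂ f)
    (hM : ∀ z : ℂ, ‖z‖ = R → ‖f z‖ ≤ M) {z : ℂ} (hz : ‖z‖ ≤ R) : ‖f z‖ ≤ M := by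
  refine Complex.norm_le_of_forall_mem_frontier_norm_le (U := ball (0 : ℂ) R) isBounded_ball
    hf.diffContOnCl (fun w hw => ?_) ?_
  · rw [frontier_ball _ hR.ne'] at hw
    exact hM w (by simpa using hw)
  · rw [closure_ball _ hR.ne']; simpa using hz

lemma differentiable_dslope {f : ℂ → ℂ} (hf : Differentiable ℂ f) (a : ℂ) :
    Differentiable ℂ (dslope f a) := by
  rw [← differentiableOn_univ] at hf ⊢
  exact (Complex.differentiableOn_dslope univ_mem).2 hf

lemma norm_sq_sub_conj_mul {a z : ℂ} {R : ℝ} (hz : ‖z‖ = R) :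
    ‖(R : ℂ) ^ 2 - (starRingEnd ℂ) a * z‖ = R * ‖z - a‖ := by
  have h1 : (R : ℂ) ^ 2 = (starRingEnd ℂ) z * z := by
    rw [← hz, ← Complex.normSq_eq_conj_mul_self, Complex.normSq_eq_norm_sq]; push_cast; rfl
  rw [h1, ← sub_mul, ← map_sub, norm_mul, RCLike.norm_conj, hz, mul_comm]

lemma le_norm_sq_sub_conj_mul {a z : ℂ} {R : ℝ} (ha : ‖a‖ ≤ R) :
    R * (R - ‖z‖) ≤ ‖(R : ℂ) ^ 2 - (starRingEnd ℂ) a * z‖ := by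
  have h1 := norm_sub_norm_le ((R : ℂ) ^ 2) ((starRingEnd ℂ) a * z)
  have h2 : ‖(R : ℂ) ^ 2‖ = R ^ 2 := by simp
  rw [h2, norm_mul, RCLike.norm_conj] at h1
  have h3 : ‖a‖ * ‖z‖ ≤ R * ‖z‖ := by gcongr
  linarith

lemma exists_finset_norm_logDeriv_le {R R₁ M ε A : ℝ} (hR₁ : 0 < R₁) (hR : R₁ < R)
    (hε : 0 < ε) : ∀ (k : ℕ) (m : ℝ) (q : ℂ → ℂ), 0 < m → Real.log (M / m) + 1 ≤ A →
    Differentiable ℂ q → (∀ z : ℂ, ‖z‖ = R → ‖q z‖ ≤ M) → m ≤ ‖q 0‖ →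
    M < m * (R / R₁) ^ k →
    ∃ s : Finset ℝ, s.card ≤ k ∧ ∀ z : ℂ, ‖z‖ + 2 * ε ≤ R₁ → ∀ η : ℝ, 0 < η →
      (∀ a ∈ s, η ≤ |‖z‖ - a|) →
      q z ≠ 0 ∧ ‖deriv q z / q z‖ ≤ k * (1 / η + 1 / (R - ‖z‖)) + 2 * A * R₁ / ε ^ 2 := by
  have hRp : 0 < R := hR₁.trans hR
  intro k
  induction k with
  | zero =>
    intro m q hm hA hq hM hm0 hk
    have := norm_le_of_forall_sphere hRp hq hM (z := 0) (by simpa using hRp.le)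
    simp only [pow_zero, mul_one] at hk
    linarith
  | succ k ih =>
    intro m q hm hA hq hM hm0 hk
    have hmax : ∀ z : ℂ, ‖z‖ ≤ R → ‖q z‖ ≤ M := fun z hz => norm_le_of_forall_sphere hRp hq hM hz
    have hmM : m ≤ M := hm0.trans (hmax 0 (by simpa using hRp.le))
    by_cases hzero : ∀ w ∈ ball (0 : ℂ) R₁, q w ≠ 0
    · refine ⟨∅, by simp, fun z hz η hη _ => ⟨hzero z ?_, ?_⟩⟩
      · rw [mem_ball_zero_iff]; linarith
      · have h1 := norm_logDeriv_le_of_forall_ne_zero hq.differentiableOn hzero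
          (fun w hw => hmax w (by rw [mem_ball_zero_iff] at hw; linarith)) hm hm0 hA hε hz
        have h2 : 0 ≤ ((k + 1 : ℕ) : ℝ) * (1 / η + 1 / (R - ‖z‖)) := by
          have : 0 < R - ‖z‖ := by linarith
          positivity
        linarith
    · push Not at hzero
      obtain ⟨a, ha, hqa⟩ := hzero
      rw [mem_ball_zero_iff] at ha
      have ha0 : a ≠ 0 := by
        rintro rfl
        rw [hqa, norm_zero] at hm0; linarith
      have hna : 0 < ‖a‖ := norm_pos_iff.2 ha0
      set g : ℂ → ℂ := fun z => dslope q a z * (((R : ℂ) ^ 2 - (starRingEnd ℂ) a * z) / R) with hg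
      have hgd : Differentiable ℂ g := by
        refine (differentiable_dslope hq a).mul ?_
        fun_prop
      have hRc : (R : ℂ) ≠ 0 := by exact_mod_cast hRp.ne'
      have heq : ∀ z, q z * ((R : ℂ) ^ 2 - (starRingEnd ℂ) a * z) = g z * ((z - a) * R) := by
        intro z
        have := sub_smul_dslope q a z
        rw [hqa, sub_zero, smul_eq_mul] at this
        rw [hg, ← this]
        field_simp
      have heqn : ∀ z, ‖q z‖ * ‖(R : ℂ) ^ 2 - (starRingEnd ℂ) a * z‖ = ‖g z‖ * (‖z - a‖ * R) := by
        intro z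
        have := congrArg norm (heq z)
        rwa [norm_mul, norm_mul (g z), norm_mul (z - a), Complex.norm_of_nonneg hRp.le] at this
      have hgM : ∀ z : ℂ, ‖z‖ = R → ‖g z‖ ≤ M := by
        intro z hz
        have h1 := heqn z
        rw [norm_sq_sub_conj_mul hz] at h1
        have h2 : 0 < ‖z - a‖ := by
          rw [norm_pos_iff, sub_ne_zero]; rintro rfl; linarith
        have h3 : ‖q z‖ = ‖g z‖ := by
          apply mul_right_cancel₀ (mul_pos hRp h2).ne'
          rw [h1]; ring
        rw [← h3]; exact hM z hz
      have hg0 : m * (R / R₁) ≤ ‖g 0‖ := by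
        have h1 := heqn 0
        have h2 : ‖(R : ℂ) ^ 2‖ = R ^ 2 := by simp
        simp only [mul_zero, sub_zero, zero_sub, norm_neg, h2] at h1
        have h3 : ‖g 0‖ * ‖a‖ = ‖q 0‖ * R := by
          apply mul_right_cancel₀ hRp.ne'
          linarith
        rw [mul_div_assoc', div_le_iff₀ hR₁]
        calc m * R ≤ ‖q 0‖ * R := by gcongr
          _ = ‖g 0‖ * ‖a‖ := h3.symm
          _ ≤ ‖g 0‖ * R₁ := by gcongr
      have hone : 1 ≤ R / R₁ := by rw [one_le_div hR₁]; exact hR.le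
      have hm' : m ≤ m * (R / R₁) := le_mul_of_one_le_right hm.le hone
      have hmp : 0 < m * (R / R₁) := hm.trans_le hm'
      obtain ⟨s, hs, hs'⟩ := ih (m * (R / R₁)) g hmp
        (by
          refine le_trans ?_ hA
          have : Real.log (M / (m * (R / R₁))) ≤ Real.log (M / m) := by
            apply Real.log_le_log
            · exact div_pos (hm.trans_le hmM) hmp
            · exact div_le_div_of_nonneg_left (hm.trans_le hmM).le hm hm'
          linarith) hgd hgM hg0
        (by rw [pow_succ'] at hk; linarith)
      refine ⟨insert ‖a‖ s, (Finset.card_insert_le _ _).trans (by omega), fun z hz η hη hzs => ?_⟩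
      obtain ⟨hgz, hgb⟩ := hs' z hz η hη fun b hb => hzs b (Finset.mem_insert_of_mem hb)
      have hza : η ≤ ‖z - a‖ := (hzs ‖a‖ (Finset.mem_insert_self _ _)).trans (abs_norm_sub_norm_le z a)
      have hza0 : z - a ≠ 0 := norm_pos_iff.1 (hη.trans_le hza)
      have hRz : 0 < R - ‖z‖ := by linarith
      have hlow := le_norm_sq_sub_conj_mul (z := z) (ha.trans hR).le
      have hB : (R : ℂ) ^ 2 - (starRingEnd ℂ) a * z ≠ 0 :=
        norm_pos_iff.1 ((mul_pos hRp hRz).trans_le hlow)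
      have hqz : q z ≠ 0 := by
        intro h
        have h1 := heq z
        rw [h, zero_mul] at h1
        exact mul_ne_zero hgz (mul_ne_zero hza0 hRc) h1.symm
      refine ⟨hqz, ?_⟩
      have hd : deriv q z * ((R : ℂ) ^ 2 - (starRingEnd ℂ) a * z) + q z * (-(starRingEnd ℂ) a)
          = deriv g z * ((z - a) * R) + g z * R := by
        have e1 : HasDerivAt (fun z => q z * ((R : ℂ) ^ 2 - (starRingEnd ℂ) a * z))
            (deriv q z * ((R : ℂ) ^ 2 - (starRingEnd ℂ) a * z) + q z * (-(starRingEnd ℂ) a)) z := by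
          refine (hq z).hasDerivAt.mul ?_
          simpa using ((hasDerivAt_id z).const_mul ((starRingEnd ℂ) a)).const_sub ((R : ℂ) ^ 2)
        have e2 : HasDerivAt (fun z => g z * ((z - a) * R))
            (deriv g z * ((z - a) * R) + g z * R) z := by
          refine (hgd z).hasDerivAt.mul ?_
          simpa using ((hasDerivAt_id z).sub_const a).mul_const (R : ℂ)
        have e3 : (fun z => q z * ((R : ℂ) ^ 2 - (starRingEnd ℂ) a * z)) =
          fun z => g z * ((z - a) * R) := funext heq
        rw [e3] at e1
        exact e1.unique e2
      have hform : deriv q z / q z = deriv g z / g z + 1 / (z - a)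
          + (starRingEnd ℂ) a / ((R : ℂ) ^ 2 - (starRingEnd ℂ) a * z) := by
        have h1 : deriv q z / q z - (starRingEnd ℂ) a / ((R : ℂ) ^ 2 - (starRingEnd ℂ) a * z)
            = (deriv q z * ((R : ℂ) ^ 2 - (starRingEnd ℂ) a * z) + q z * (-(starRingEnd ℂ) a)) /
              (q z * ((R : ℂ) ^ 2 - (starRingEnd ℂ) a * z)) := by
          field_simp
          ring
        rw [hd, heq z] at h1
        have h2 : (deriv g z * ((z - a) * R) + g z * R) / (g z * ((z - a) * R))
            = deriv g z / g z + 1 / (z - a) := by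
          field_simp
        rw [h2] at h1
        linear_combination h1
      rw [hform]
      have hn1 : ‖1 / (z - a)‖ ≤ 1 / η := by
        rw [norm_div, norm_one]
        exact one_div_le_one_div_of_le hη hza
      have hn2 : ‖(starRingEnd ℂ) a / ((R : ℂ) ^ 2 - (starRingEnd ℂ) a * z)‖ ≤ 1 / (R - ‖z‖) := by
        rw [norm_div, RCLike.norm_conj, div_le_div_iff₀ ((mul_pos hRp hRz).trans_le hlow) hRz]
        calc ‖a‖ * (R - ‖z‖) ≤ R * (R - ‖z‖) := by gcongr; linarith
          _ ≤ _ := by linarith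
      calc _ ≤ ‖deriv g z / g z‖ + ‖1 / (z - a)‖ + ‖(starRingEnd ℂ) a / ((R : ℂ) ^ 2 - (starRingEnd ℂ) a * z)‖ :=
            norm_add₃_le
        _ ≤ _ := by push_cast; linarith

lemma exists_eq_pow_mul_of_ne_zero {f : ℂ → ℂ} (hf : Differentiable ℂ f) (h0 : f ≠ 0) :
    ∃ (m : ℕ) (q : ℂ → ℂ), Differentiable ℂ q ∧ q 0 ≠ 0 ∧ ∀ z, f z = z ^ m * q z := by
  obtain ⟨p, hp⟩ := hf.analyticAt 0
  have hp0 : p ≠ 0 := by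
    intro h
    have h1 := (hp.locally_zero_iff).2 h
    apply h0
    have h2 : AnalyticOnNhd ℂ f Set.univ := fun z _ => hf.analyticAt z
    exact h2.eq_of_eventuallyEq (fun z _ => analyticAt_const) h1
  refine ⟨p.order, (Function.swap dslope 0)^[p.order] f, ?_,
    hp.iterate_dslope_fslope_ne_zero hp0, fun z => ?_⟩
  · generalize p.order = n
    induction n with
    | zero => simpa
    | succ n ih => rw [Function.iterate_succ_apply']; exact differentiable_dslope ih 0
  · simpa using hp.eq_pow_order_mul_iterate_dslope z

lemma exists_eq_prod_mul_aux {R : ℝ} (hR : 0 < R) : ∀ (k : ℕ) (M m : ℝ) (q : ℂ → ℂ), 0 < m →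
    Differentiable ℂ q → (∀ z : ℂ, ‖z‖ = 3 * R → ‖q z‖ ≤ M) → m ≤ ‖q 0‖ → M < m * 2 ^ k →
    ∃ s : Multiset ℂ, (∀ a ∈ s, ‖a‖ < R) ∧ ∃ g : ℂ → ℂ, Differentiable ℂ g ∧
      (∀ z, q z = (s.map fun a => z - a).prod * g z) ∧ ∀ z ∈ ball (0 : ℂ) R, g z ≠ 0 := by
  intro k
  induction k with
  | zero =>
    intro M m q hm hq hM hm0 hk
    have := norm_le_of_forall_sphere (by linarith) hq hM (z := 0) (by simpa using hR.le)
    simp only [pow_zero, mul_one] at hk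
    linarith
  | succ k ih =>
    intro M m q hm hq hM hm0 hk
    by_cases hzero : ∀ w ∈ ball (0 : ℂ) R, q w ≠ 0
    · exact ⟨0, by simp, q, hq, by simp, hzero⟩
    · push Not at hzero
      obtain ⟨a, ha, hqa⟩ := hzero
      rw [mem_ball_zero_iff] at ha
      have heq : ∀ z, (z - a) * dslope q a z = q z := fun z => sub_smul_dslope_of_zero hqa z
      obtain ⟨s, hs, g, hg, hgs, hg0⟩ := ih (M / (2 * R)) (m / R) (dslope q a) (by positivity)
        (differentiable_dslope hq a)
        (fun z hz => by
          rw [le_div_iff₀ (by linarith)]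
          have h1 : 2 * R ≤ ‖z - a‖ := by
            have := norm_sub_norm_le z a
            linarith
          calc _ ≤ ‖dslope q a z‖ * ‖z - a‖ := by gcongr
            _ = ‖q z‖ := by rw [← heq z, norm_mul, mul_comm]
            _ ≤ M := hM z hz)
        (by
          rw [div_le_iff₀ hR]
          calc m ≤ ‖q 0‖ := hm0
            _ = ‖dslope q a 0‖ * ‖a‖ := by rw [← heq 0, norm_mul, mul_comm]; simp
            _ ≤ _ := by gcongr)
        (by
          rw [div_lt_iff₀ (by linarith)]
          rw [pow_succ] at hk
          calc M < _ := hk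
            _ = _ := by field_simp)
      refine ⟨a ::ₘ s, ?_, g, hg, fun z => ?_, hg0⟩
      · intro b hb
        rcases Multiset.mem_cons.1 hb with rfl | hb
        exacts [ha, hs b hb]
      · rw [← heq z, hgs z]; simp [mul_assoc]

lemma exists_eq_prod_mul {f : ℂ → ℂ} {R : ℝ} (hR : 0 < R) (hf : Differentiable ℂ f) (h0 : f ≠ 0) :
    ∃ s : Multiset ℂ, (∀ a ∈ s, ‖a‖ < R) ∧ ∃ g : ℂ → ℂ, Differentiable ℂ g ∧
      (∀ z, f z = (s.map fun a => z - a).prod * g z) ∧ ∀ z ∈ ball (0 : ℂ) R, g z ≠ 0 := by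
  obtain ⟨m, q, hq, hq0, hfq⟩ := exists_eq_pow_mul_of_ne_zero hf h0
  obtain ⟨M, hM⟩ := (isCompact_sphere (0 : ℂ) (3 * R)).exists_bound_of_continuousOn
    hq.continuous.continuousOn
  have hp : 0 < ‖q 0‖ := norm_pos_iff.2 hq0
  obtain ⟨k, hk⟩ := pow_unbounded_of_one_lt (M / ‖q 0‖) (one_lt_two (α := ℝ))
  rw [div_lt_iff₀ hp, mul_comm] at hk
  obtain ⟨s, hs, g, hg, hgs, hg0⟩ := exists_eq_prod_mul_aux hR k M ‖q 0‖ q hp hq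
    (fun z hz => hM z (by simpa using hz)) le_rfl hk
  refine ⟨Multiset.replicate m 0 + s, ?_, g, hg, fun z => ?_, hg0⟩
  · intro a ha
    rcases Multiset.mem_add.1 ha with h | h
    · rw [Multiset.eq_of_mem_replicate h]; simpa
    · exact hs a h
  · rw [hfq, hgs]; simp [mul_assoc]

/-- Replacing the zeros `a` in the disc by their reflections does not change the modulus on the
circle, and increases it inside. -/
lemma exists_ne_zero_majorant {f : ℂ → ℂ} {R : ℝ} (hR : 0 < R) (hf : Differentiable ℂ f)
    (h0 : f ≠ 0) : ∃ G : ℂ → ℂ, Differentiable ℂ G ∧ (∀ z ∈ ball (0 : ℂ) R, G z ≠ 0) ∧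
      (∀ z : ℂ, ‖z‖ = R → ‖G z‖ = ‖f z‖) ∧ ∀ z : ℂ, ‖z‖ ≤ R → ‖f z‖ ≤ ‖G z‖ := by
  obtain ⟨s, hs, g, hg, hgs, hg0⟩ := exists_eq_prod_mul hR hf h0
  suffices H : ∀ s : Multiset ℂ, (∀ a ∈ s, ‖a‖ < R) → ∃ p : ℂ → ℂ, Differentiable ℂ p ∧
      (∀ z ∈ ball (0 : ℂ) R, p z ≠ 0) ∧
      (∀ z : ℂ, ‖z‖ = R → ‖p z‖ = ‖(s.map fun a => z - a).prod‖) ∧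
      ∀ z : ℂ, ‖z‖ ≤ R → ‖(s.map fun a => z - a).prod‖ ≤ ‖p z‖ by
    obtain ⟨p, hp, hp0, hp1, hp2⟩ := H s hs
    refine ⟨fun z => p z * g z, hp.mul hg, fun z hz => mul_ne_zero (hp0 z hz) (hg0 z hz),
      fun z hz => ?_, fun z hz => ?_⟩
    · rw [hgs, norm_mul, norm_mul, hp1 z hz]
    · rw [hgs, norm_mul, norm_mul]
      gcongr
      exact hp2 z hz
  clear hs hgs
  intro s
  induction s using Multiset.induction_on with
  | empty => exact fun _ => ⟨1, differentiable_const _, by simp, by simp, by simp⟩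
  | cons a s ih =>
    intro hs
    obtain ⟨p, hp, hp0, hp1, hp2⟩ := ih fun b hb => hs b (Multiset.mem_cons_of_mem hb)
    have ha := hs a (Multiset.mem_cons_self a s)
    have hnorm : ∀ z : ℂ, ‖((R : ℂ) ^ 2 - (starRingEnd ℂ) a * z) / R‖
        = ‖(R : ℂ) ^ 2 - (starRingEnd ℂ) a * z‖ / R := fun z => by
      rw [norm_div, Complex.norm_of_nonneg hR.le]
    refine ⟨fun z => ((R : ℂ) ^ 2 - (starRingEnd ℂ) a * z) / R * p z, ?_, ?_, ?_, ?_⟩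
    · exact (Differentiable.div_const (by fun_prop) _).mul hp
    · intro z hz
      refine mul_ne_zero (div_ne_zero (norm_pos_iff.1 ?_) (by exact_mod_cast hR.ne')) (hp0 z hz)
      rw [mem_ball_zero_iff] at hz
      exact (mul_pos hR (by linarith)).trans_le (le_norm_sq_sub_conj_mul ha.le)
    · intro z hz
      rw [Multiset.map_cons, Multiset.prod_cons, norm_mul, norm_mul, hnorm,
        norm_sq_sub_conj_mul hz, hp1 z hz, mul_div_cancel_left₀ _ hR.ne']
    · intro z hz
      rw [Multiset.map_cons, Multiset.prod_cons, norm_mul, norm_mul, hnorm]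
      gcongr
      · rw [le_div_iff₀ hR]
        have h1 : ‖(z - a) * (R : ℂ)‖ ^ 2 ≤ ‖(R : ℂ) ^ 2 - (starRingEnd ℂ) a * z‖ ^ 2 := by
          have e : ‖(R : ℂ) ^ 2 - (starRingEnd ℂ) a * z‖ ^ 2 - ‖(z - a) * (R : ℂ)‖ ^ 2
              = (R ^ 2 - ‖z‖ ^ 2) * (R ^ 2 - ‖a‖ ^ 2) := by
            have hre : ((R : ℂ) ^ 2).re = R ^ 2 := by norm_cast
            have him : ((R : ℂ) ^ 2).im = 0 := by norm_cast
            simp only [← Complex.normSq_eq_norm_sq, Complex.normSq_apply]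
            simp [hre, him]
            ring
          have : 0 ≤ (R ^ 2 - ‖z‖ ^ 2) * (R ^ 2 - ‖a‖ ^ 2) := by
            apply mul_nonneg <;> · rw [sub_nonneg]; gcongr
          linarith
        have h2 := abs_le_of_sq_le_sq h1 (norm_nonneg _)
        rwa [abs_norm, norm_mul, Complex.norm_of_nonneg hR.le] at h2
      · exact hp2 z hz

lemma posLog_norm_le_mul_proximity {f : ℂ → ℂ} {R : ℝ} {w : ℂ} (hf : Differentiable ℂ f)
    (hw : ‖w‖ < R) :
    Real.posLog ‖f w‖ ≤ (R + ‖w‖) / (R - ‖w‖) * ValueDistribution.proximity f ⊤ R := by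
  have hw0 := norm_nonneg w
  have hR : 0 < R := by linarith
  have hnn : 0 ≤ (R + ‖w‖) / (R - ‖w‖) * ValueDistribution.proximity f ⊤ R :=
    mul_nonneg (div_nonneg (by linarith) (by linarith)) (ValueDistribution.proximity_nonneg R)
  by_cases h0 : f = 0
  · simpa [h0] using h0 ▸ hnn
  obtain ⟨G, hG, hG0, hG1, hG2⟩ := exists_ne_zero_majorant hR hf h0
  have hprox : ValueDistribution.proximity f ⊤ R = ValueDistribution.proximity G ⊤ R := by
    rw [ValueDistribution.proximity_top, ValueDistribution.proximity_top]
    apply Real.circleAverage_congr_sphere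
    intro z hz
    rw [abs_of_pos hR] at hz
    simp only
    rw [hG1 z (by simpa using hz)]
  rw [hprox] at hnn ⊢
  refine max_le_iff.2 ?_
  refine ⟨hnn, ?_⟩
  have key : ∀ t ∈ Set.Ioo ‖w‖ R,
      Real.log ‖G w‖ ≤ (t + ‖w‖) / (t - ‖w‖) * ValueDistribution.proximity G ⊤ t := by
    intro t ht
    have ht0 : 0 < t := by linarith [ht.1]
    have hwt : w ∈ ball (0 : ℂ) t := by simpa using ht.1
    have hne : ∀ z ∈ closedBall (0 : ℂ) t, G z ≠ 0 := fun z hz =>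
      hG0 z (closedBall_subset_ball ht.2 hz)
    have hP := InnerProductSpace.HarmonicOnNhd.circleAverage_re_herglotzRieszKernel_smul
      (f := fun z => Real.log ‖G z‖) (c := 0) (R := t) (w := w)
      (fun z hz => (hG.analyticAt z).harmonicAt_log_norm (hne z hz)) hwt
    rw [← hP, ValueDistribution.proximity_top, ← smul_eq_mul, ← Real.circleAverage_fun_smul]
    apply Real.circleAverage_mono
    · apply ContinuousOn.circleIntegrable'
      apply ContinuousOn.smul
      · exact Complex.continuous_re.comp_continuousOn (continuousOn_herglotzRieszKernel_sphere hwt)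
      · apply ContinuousOn.log hG.continuous.norm.continuousOn
        intro z hz
        rw [abs_of_pos ht0] at hz
        exact norm_ne_zero_iff.2 (hne z (sphere_subset_closedBall hz))
    · apply ContinuousOn.circleIntegrable'
      have := hG.continuous
      fun_prop
    · intro z hz
      rw [abs_of_pos ht0] at hz
      have h1 := re_herglotzRieszKernel_le hz hwt
      have h2 := le_re_herglotzRieszKernel hz hwt
      simp only [sub_zero] at h1 h2
      have h3 : 0 ≤ (t - ‖w‖) / (t + ‖w‖) := div_nonneg (by linarith [ht.1]) (by linarith)
      simp only [Pi.smul_apply', Function.comp_apply, herglotzRieszKernel_def, sub_zero,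
        smul_eq_mul]
      have h4 : Real.log ‖G z‖ ≤ Real.posLog ‖G z‖ := le_max_right _ _
      calc _ ≤ ((z + w) / (z - w)).re * Real.posLog ‖G z‖ :=
            mul_le_mul_of_nonneg_left h4 (h3.trans h2)
        _ ≤ _ := mul_le_mul_of_nonneg_right h1 Real.posLog_nonneg
  have hlim : Tendsto (fun t => (t + ‖w‖) / (t - ‖w‖) * ValueDistribution.proximity G ⊤ t)
      (nhdsWithin R (Set.Iio R))
      (nhds ((R + ‖w‖) / (R - ‖w‖) * ValueDistribution.proximity G ⊤ R)) := by
    apply Tendsto.mono_left _ nhdsWithin_le_nhds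
    have h1 : ContinuousAt (fun t : ℝ => (t + ‖w‖) / (t - ‖w‖)) R := by
      apply ContinuousAt.div (by fun_prop) (by fun_prop)
      linarith
    exact h1.mul (ValueDistribution.continuous_proximity_top hG.continuous).continuousAt
  have hGw : Real.log ‖G w‖ ≤ (R + ‖w‖) / (R - ‖w‖) * ValueDistribution.proximity G ⊤ R :=
    ge_of_tendsto hlim (by
      filter_upwards [Ioo_mem_nhdsLT hw] with t ht using key t ht)
  by_cases hfw : f w = 0
  · simpa [hfw] using hnn
  · exact (Real.log_le_log (norm_pos_iff.2 hfw) (hG2 w hw.le)).trans hGw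

/-- The quantity `R (1 + τ R) / (R - r)`, in powers of which all bounds are expressed. -/
noncomputable def growthRatio (τ : ℝ → ℝ) (r R : ℝ) : ℝ := R * (1 + τ R) / (R - r)

/-- `p` is entire and `log⁺ |p|` is polynomially bounded in the growth ratio. -/
def ExpBounded (τ : ℝ → ℝ) (p : ℂ → ℂ) : Prop :=
  Differentiable ℂ p ∧ ∃ C : ℕ, ∀ r R : ℝ, 1 ≤ r → r < R → R ≤ r + 1 → ∀ z : ℂ, ‖z‖ ≤ r →
    ‖p z‖ ≤ Real.exp (C * growthRatio τ r R ^ C)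

/-- `Φ z B` holds with a polynomial bound `B`, off thin annuli about few exceptional radii. -/
def HoldsOff (τ : ℝ → ℝ) (Φ : ℂ → ℝ → Prop) : Prop :=
  ∃ C : ℕ, ∀ r R : ℝ, 1 ≤ r → r < R → R ≤ r + 1 → ∃ s : Finset ℝ,
    (s.card : ℝ) ≤ C * growthRatio τ r R ^ C ∧ ∀ z : ℂ, r ≤ ‖z‖ → ‖z‖ ≤ (r + R) / 2 →
      ∀ η : ℝ, 0 < η → η ≤ 1 → (∀ a ∈ s, η ≤ |‖z‖ - a|) → Φ z (C * (growthRatio τ r R / η) ^ C)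

/-- `g` is polynomially bounded off thin annuli about few exceptional radii. -/
def PolyBoundedOff (τ : ℝ → ℝ) (g : ℂ → ℂ) : Prop := HoldsOff τ fun z B => ‖g z‖ ≤ B

lemma natCast_mul_pow_le {Q : ℝ} (hQ : 1 ≤ Q) {C D : ℕ} (h : C ≤ D) :
    (C : ℝ) * Q ^ C ≤ D * Q ^ D := by
  gcongr

section
variable {τ : ℝ → ℝ} {r R : ℝ}

lemma le_growthRatio (hτ : ∀ t, 0 ≤ τ t) (h1 : 1 ≤ r) (h2 : r < R) (h3 : R ≤ r + 1) :
    R ≤ growthRatio τ r R := by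
  have := hτ R
  rw [growthRatio, le_div_iff₀ (by linarith)]
  have : R * (R - r) ≤ R * 1 := by apply mul_le_mul_of_nonneg_left <;> linarith
  nlinarith

lemma one_le_growthRatio (hτ : ∀ t, 0 ≤ τ t) (h1 : 1 ≤ r) (h2 : r < R) (h3 : R ≤ r + 1) :
    1 ≤ growthRatio τ r R := by
  linarith [le_growthRatio hτ h1 h2 h3]

lemma div_sub_le_growthRatio (hτ : ∀ t, 0 ≤ τ t) (h1 : 1 ≤ r) (h2 : r < R) :
    R / (R - r) ≤ growthRatio τ r R := by
  have := hτ R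
  rw [growthRatio]
  gcongr
  exact le_mul_of_one_le_right (by linarith) (by linarith)

lemma one_div_sub_le_growthRatio (hτ : ∀ t, 0 ≤ τ t) (h1 : 1 ≤ r) (h2 : r < R) :
    1 / (R - r) ≤ growthRatio τ r R := by
  refine le_trans ?_ (div_sub_le_growthRatio hτ h1 h2)
  gcongr
  linarith

lemma growthRatio_midpoint : growthRatio τ ((r + R) / 2) R = 2 * growthRatio τ r R := by
  rw [growthRatio, growthRatio, show R - (r + R) / 2 = (R - r) / 2 by ring]
  rw [div_div_eq_mul_div]; ring

namespace ExpBounded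

lemma const (c : ℂ) (hτ : ∀ t, 0 ≤ τ t) : ExpBounded τ fun _ => c := by
  obtain ⟨N, hN⟩ := exists_nat_ge ‖c‖
  refine ⟨differentiable_const _, N, fun r R h1 h2 h3 z _ => ?_⟩
  have hQ := one_le_growthRatio hτ h1 h2 h3
  have : (N : ℝ) ≤ N * growthRatio τ r R ^ N :=
    le_mul_of_one_le_right (Nat.cast_nonneg _) (one_le_pow₀ hQ)
  linarith [Real.add_one_le_exp (N * growthRatio τ r R ^ N)]

lemma mul {p q : ℂ → ℂ} (hτ : ∀ t, 0 ≤ τ t) (hp : ExpBounded τ p) (hq : ExpBounded τ q) :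
    ExpBounded τ fun z => p z * q z := by
  obtain ⟨hp, C, hC⟩ := hp
  obtain ⟨hq, D, hD⟩ := hq
  refine ⟨hp.mul hq, C + D, fun r R h1 h2 h3 z hz => ?_⟩
  have hQ := one_le_growthRatio hτ h1 h2 h3
  have e1 : growthRatio τ r R ^ C ≤ growthRatio τ r R ^ (C + D) := by gcongr; omega
  have e2 : growthRatio τ r R ^ D ≤ growthRatio τ r R ^ (C + D) := by gcongr; omega
  calc ‖p z * q z‖ = ‖p z‖ * ‖q z‖ := norm_mul _ _
    _ ≤ Real.exp (C * growthRatio τ r R ^ C) * Real.exp (D * growthRatio τ r R ^ D) :=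
      mul_le_mul (hC r R h1 h2 h3 z hz) (hD r R h1 h2 h3 z hz) (norm_nonneg _) (Real.exp_nonneg _)
    _ = Real.exp (C * growthRatio τ r R ^ C + D * growthRatio τ r R ^ D) := (Real.exp_add _ _).symm
    _ ≤ _ := by
      push_cast
      rw [add_mul]
      gcongr

lemma add {p q : ℂ → ℂ} (hτ : ∀ t, 0 ≤ τ t) (hp : ExpBounded τ p) (hq : ExpBounded τ q) :
    ExpBounded τ fun z => p z + q z := by
  obtain ⟨hp, C, hC⟩ := hp
  obtain ⟨hq, D, hD⟩ := hq
  refine ⟨hp.add hq, C + D + 1, fun r R h1 h2 h3 z hz => ?_⟩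
  have hQ := one_le_growthRatio hτ h1 h2 h3
  have e1 : growthRatio τ r R ^ C ≤ growthRatio τ r R ^ (C + D + 1) := by gcongr; omega
  have e2 : growthRatio τ r R ^ D ≤ growthRatio τ r R ^ (C + D + 1) := by gcongr; omega
  have e3 : 1 ≤ growthRatio τ r R ^ (C + D + 1) := one_le_pow₀ hQ
  have hx : 0 ≤ (C : ℝ) * growthRatio τ r R ^ C := by positivity
  have hy : 0 ≤ (D : ℝ) * growthRatio τ r R ^ D := by positivity
  have hx' := Real.one_le_exp hx
  have hy' := Real.one_le_exp hy
  have h4 := hC r R h1 h2 h3 z hz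
  have h5 := hD r R h1 h2 h3 z hz
  calc ‖p z + q z‖ ≤ ‖p z‖ + ‖q z‖ := norm_add_le _ _
    _ ≤ 2 * (Real.exp (C * growthRatio τ r R ^ C) * Real.exp (D * growthRatio τ r R ^ D)) := by
      nlinarith
    _ ≤ Real.exp 1 * (Real.exp (C * growthRatio τ r R ^ C) * Real.exp (D * growthRatio τ r R ^ D)) := by
      gcongr
      linarith [Real.add_one_le_exp (1 : ℝ)]
    _ = Real.exp (C * growthRatio τ r R ^ C + D * growthRatio τ r R ^ D + 1) := by
      rw [Real.exp_add, Real.exp_add]; ring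
    _ ≤ _ := by
      push_cast
      rw [add_mul, add_mul, one_mul]
      gcongr

lemma sub {p q : ℂ → ℂ} (hτ : ∀ t, 0 ≤ τ t) (hp : ExpBounded τ p) (hq : ExpBounded τ q) :
    ExpBounded τ fun z => p z - q z := by
  simpa [sub_eq_add_neg] using hp.add hτ ((const (-1) hτ).mul hτ hq)

lemma deriv {p : ℂ → ℂ} (hτ : ∀ t, 0 ≤ τ t) (hp : ExpBounded τ p) :
    ExpBounded τ (deriv p) := by
  obtain ⟨hp, C, hC⟩ := hp
  refine ⟨hp.deriv, 2 + C * 2 ^ C, fun r R h1 h2 h3 z hz => ?_⟩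
  have hQ := one_le_growthRatio hτ h1 h2 h3
  have hd := one_div_sub_le_growthRatio hτ h1 h2
  have hδ : 0 < (R - r) / 2 := by linarith
  have := Complex.norm_deriv_le_of_forall_mem_sphere_norm_le hδ (hp.diffContOnCl (s := ball z _))
    (C := Real.exp (C * (2 * growthRatio τ r R) ^ C)) (fun w hw => by
      rw [← growthRatio_midpoint]
      refine hC _ _ (by linarith) (by linarith) (by linarith) w ?_
      have h4 : ‖w - z‖ = (R - r) / 2 := by simpa [dist_eq_norm] using hw
      calc ‖w‖ = ‖z + (w - z)‖ := by ring_nf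
        _ ≤ ‖z‖ + ‖w - z‖ := norm_add_le _ _
        _ ≤ _ := by rw [h4]; linarith)
  have hC2 : C ≤ 2 + C * 2 ^ C := by
    have : C * 1 ≤ C * 2 ^ C := Nat.mul_le_mul_left _ Nat.one_le_two_pow
    omega
  calc ‖_root_.deriv p z‖ ≤ _ := this
    _ = 2 * (1 / (R - r)) * Real.exp (C * (2 * growthRatio τ r R) ^ C) := by
      field_simp
    _ ≤ Real.exp (2 * growthRatio τ r R) * Real.exp (C * (2 * growthRatio τ r R) ^ C) := by
      gcongr
      linarith [Real.add_one_le_exp (2 * growthRatio τ r R)]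
    _ = Real.exp (2 * growthRatio τ r R ^ 1 + C * 2 ^ C * growthRatio τ r R ^ C) := by
      rw [← Real.exp_add]; ring_nf
    _ ≤ _ := by
      push_cast
      rw [add_mul]
      gcongr
      omega

lemma iteratedDeriv {p : ℂ → ℂ} (hτ : ∀ t, 0 ≤ τ t) (hp : ExpBounded τ p) (j : ℕ) :
    ExpBounded τ (iteratedDeriv j p) := by
  induction j with
  | zero => simpa using hp
  | succ j ih => rw [iteratedDeriv_succ]; exact ih.deriv hτ

lemma sum {ι : Type*} {s : Finset ι} {p : ι → ℂ → ℂ} (hτ : ∀ t, 0 ≤ τ t)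
    (hp : ∀ i ∈ s, ExpBounded τ (p i)) : ExpBounded τ fun z => ∑ i ∈ s, p i z := by
  classical
  induction s using Finset.induction_on with
  | empty => simpa using const 0 hτ
  | insert a s ha ih =>
    simp only [Finset.sum_insert ha]
    exact (hp a (Finset.mem_insert_self _ _)).add hτ
      (ih fun i hi => hp i (Finset.mem_insert_of_mem hi))

end ExpBounded

lemma HoldsOff.combine {Φ Ψ Θ : ℂ → ℝ → Prop} (hτ : ∀ t, 0 ≤ τ t) (hΦ : HoldsOff τ Φ)
    (hΨ : HoldsOff τ Ψ) (H : ∀ z x y B, 0 ≤ x → 0 ≤ y → Φ z x → Ψ z y → (x + 1) * (y + 1) ≤ B →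
      Θ z B) : HoldsOff τ Θ := by
  classical
  obtain ⟨C, hC⟩ := hΦ
  obtain ⟨D, hD⟩ := hΨ
  have hCE : C + D ≤ (C + 1) * (D + 1) := by ring_nf; omega
  refine ⟨(C + 1) * (D + 1), fun r R h1 h2 h3 => ?_⟩
  have hQ := one_le_growthRatio hτ h1 h2 h3
  obtain ⟨s, hs, hs'⟩ := hC r R h1 h2 h3
  obtain ⟨t, ht, ht'⟩ := hD r R h1 h2 h3
  have key : ∀ x : ℝ, 1 ≤ x → (C * x ^ C + 1) * (D * x ^ D + 1)
      ≤ ((C + 1) * (D + 1) : ℕ) * x ^ ((C + 1) * (D + 1)) := by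
    intro x hx
    calc (C * x ^ C + 1) * (D * x ^ D + 1) ≤ (C * x ^ C + 1 * x ^ C) * (D * x ^ D + 1 * x ^ D) := by
          have e1 : 1 ≤ x ^ C := one_le_pow₀ hx
          have e2 : 1 ≤ x ^ D := one_le_pow₀ hx
          gcongr <;> linarith
      _ = ((C + 1) * (D + 1) : ℕ) * x ^ (C + D) := by push_cast; ring
      _ ≤ _ := by gcongr
  refine ⟨s ∪ t, ?_, fun z hz1 hz2 η hη hη1 hst => ?_⟩
  · have e1 : ((s ∪ t).card : ℝ) ≤ s.card + t.card := by exact_mod_cast Finset.card_union_le s t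
    have e2 := key _ hQ
    have e3 : 0 ≤ (C : ℝ) * growthRatio τ r R ^ C := by positivity
    have e4 : 0 ≤ (D : ℝ) * growthRatio τ r R ^ D := by positivity
    nlinarith
  · have hx : 1 ≤ growthRatio τ r R / η := by rw [one_le_div hη]; linarith
    exact H z _ _ _ (by positivity) (by positivity)
      (hs' z hz1 hz2 η hη hη1 fun a ha => hst a (Finset.mem_union_left _ ha))
      (ht' z hz1 hz2 η hη hη1 fun a ha => hst a (Finset.mem_union_right _ ha)) (key _ hx)

lemma holdsOff_logDeriv_of_expBounded {p : ℂ → ℂ} (hτ : ∀ t, 0 ≤ τ t) (hp : ExpBounded τ p)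
    (h0 : p ≠ 0) : HoldsOff τ fun z B => p z ≠ 0 ∧ ‖deriv p z / p z‖ ≤ B := by
  obtain ⟨hp, C, hC⟩ := hp
  obtain ⟨m, q, hq, hq0, hpq⟩ := exists_eq_pow_mul_of_ne_zero hp h0
  obtain ⟨N, hN⟩ := exists_nat_ge (-Real.log ‖q 0‖)
  have hq0' : 0 < ‖q 0‖ := norm_pos_iff.2 hq0
  set D : ℕ := C * 4 ^ C + N with hD
  have hCD : C ≤ D := by
    have : C * 1 ≤ C * 4 ^ C := Nat.mul_le_mul_left _ (Nat.one_le_pow _ _ (by norm_num))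
    omega
  refine ⟨552 * D + m + 1000, fun r R h1 h2 h3 => ?_⟩
  have hQ := one_le_growthRatio hτ h1 h2 h3
  have hRQ := le_growthRatio hτ h1 h2 h3
  have hdQ := one_div_sub_le_growthRatio hτ h1 h2
  have hRdQ := div_sub_le_growthRatio hτ h1 h2
  set Q := growthRatio τ r R with hQdef
  set δ := R - r with hδ
  have hδ0 : 0 < δ := by linarith
  have hR : R = r + δ := by linarith
  set M := Real.exp (C * (4 * Q) ^ C) with hM
  set ℓ := Real.log (M / ‖q 0‖) with hℓ
  have hMp : 0 < M := Real.exp_pos _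
  have hℓle : ℓ ≤ D * Q ^ D := by
    have e0 : ℓ = C * 4 ^ C * Q ^ C - Real.log ‖q 0‖ := by
      rw [hℓ, Real.log_div hMp.ne' hq0'.ne', hM, Real.log_exp]; ring
    have e1 : Q ^ C ≤ Q ^ D := by gcongr
    have e2 : 1 ≤ Q ^ D := one_le_pow₀ hQ
    rw [e0, hD]
    push_cast
    have e3 : (N : ℝ) ≤ N * Q ^ D := le_mul_of_one_le_right (Nat.cast_nonneg _) e2
    have e4 : (C : ℝ) * 4 ^ C * Q ^ C ≤ C * 4 ^ C * Q ^ D := by gcongr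
    rw [← hD]
    nlinarith
  have hr3 : growthRatio τ (r + 3 / 4 * δ) R = 4 * Q := by
    rw [hQdef, growthRatio, growthRatio, show R - (r + 3 / 4 * δ) = (R - r) / 4 by rw [hδ]; ring]
    rw [div_div_eq_mul_div]; ring
  have hbound : ∀ z : ℂ, ‖z‖ = r + 3 / 4 * δ → ‖q z‖ ≤ M := by
    intro z hz
    have e1 := hC (r + 3 / 4 * δ) R (by linarith) (by linarith) (by linarith) z hz.le
    rw [hr3, hpq, norm_mul, norm_pow] at e1
    refine le_trans ?_ e1
    exact le_mul_of_one_le_left (norm_nonneg _) (one_le_pow₀ (by rw [hz]; linarith))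
  have hℓ0 : 0 ≤ ℓ := by
    apply Real.log_nonneg
    rw [one_le_div hq0']
    exact norm_le_of_forall_sphere (by linarith) hq hbound (z := 0) (by simp; linarith)
  set k : ℕ := ⌊8 * Q * ℓ⌋₊ + 1 with hk
  have hk1 : 8 * Q * ℓ < k := by rw [hk]; push_cast; exact Nat.lt_floor_add_one _
  have hk2 : (k : ℝ) ≤ 8 * Q * (D * Q ^ D) + 1 := by
    have : (⌊8 * Q * ℓ⌋₊ : ℝ) ≤ 8 * Q * ℓ := Nat.floor_le (by positivity)
    rw [hk]; push_cast
    have : 8 * Q * ℓ ≤ 8 * Q * (D * Q ^ D) := by gcongr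
    linarith
  have hr2 : 0 < r + 5 / 8 * δ := by linarith
  have hr3' : 0 < r + 3 / 4 * δ := by linarith
  have hlogr : 1 / (8 * Q) ≤ Real.log ((r + 3 / 4 * δ) / (r + 5 / 8 * δ)) := by
    have e1 := Real.one_sub_inv_le_log_of_pos (div_pos hr3' hr2)
    refine le_trans ?_ e1
    rw [inv_div, one_sub_div hr3'.ne', show r + 3 / 4 * δ - (r + 5 / 8 * δ) = δ / 8 by ring,
      div_le_div_iff₀ (by positivity) hr3']
    have e2 : R ≤ Q * δ := by rwa [div_le_iff₀ hδ0] at hRdQ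
    linarith
  have hklt : M < ‖q 0‖ * ((r + 3 / 4 * δ) / (r + 5 / 8 * δ)) ^ k := by
    rw [mul_comm, ← div_lt_iff₀ hq0', ← Real.log_lt_log_iff (div_pos hMp hq0')
      (pow_pos (div_pos hr3' hr2) _), Real.log_pow]
    calc ℓ < k * (1 / (8 * Q)) := by
          rw [mul_one_div, lt_div_iff₀ (by positivity)]; linarith
      _ ≤ _ := by gcongr
  obtain ⟨s, hs, hs'⟩ := exists_finset_norm_logDeriv_le (R := r + 3 / 4 * δ) (R₁ := r + 5 / 8 * δ)
    (M := M) (ε := δ / 16) (A := ℓ + 1) hr2 (by linarith) (by linarith) k ‖q 0‖ q hq0' le_rfl hq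
    hbound le_rfl hklt
  refine ⟨s, ?_, fun z hz1 hz2 η hη hη1 hzs => ?_⟩
  · calc (s.card : ℝ) ≤ k := by exact_mod_cast hs
      _ ≤ 8 * Q * (D * Q ^ D) + 1 := hk2
      _ ≤ 8 * Q * (D * Q ^ D) + 1 * Q ^ (D + 1) := by
        have : 1 ≤ Q ^ (D + 1) := one_le_pow₀ hQ
        linarith
      _ = (8 * D + 1) * Q ^ (D + 1) := by ring
      _ ≤ (552 * D + m + 1000 : ℕ) * Q ^ (552 * D + m + 1000) := by
        push_cast
        gcongr <;> first | omega | norm_num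
        · have : (0 : ℝ) ≤ m := Nat.cast_nonneg _
          linarith
  · have hz2' : ‖z‖ + 2 * (δ / 16) ≤ r + 5 / 8 * δ := by linarith
    obtain ⟨hqz, hqb⟩ := hs' z hz2' η hη hzs
    have hz0 : z ≠ 0 := norm_pos_iff.1 (by linarith)
    have hpz : p z ≠ 0 := by rw [hpq]; exact mul_ne_zero (pow_ne_zero _ hz0) hqz
    refine ⟨hpz, ?_⟩
    set t := Q / η with ht
    have htQ : Q ≤ t := by rw [ht, le_div_iff₀ hη]; nlinarith
    have ht1 : 1 ≤ t := hQ.trans htQ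
    have htη : 1 / η ≤ t := by rw [ht]; gcongr
    have hform : deriv p z / p z = m / z + deriv q z / q z := by
      have e1 : p = fun z => z ^ m * q z := funext hpq
      rw [hpq z]
      have e2 : deriv p z = m * z ^ (m - 1) * q z + z ^ m * deriv q z := by
        rw [e1]
        exact ((hasDerivAt_pow m z).mul (hq z).hasDerivAt).deriv
      rw [e2]
      rcases m with _ | m
      · simp
      · simp only [Nat.add_sub_cancel, pow_succ]
        field_simp
    have hmz : ‖(m : ℂ) / z‖ ≤ m := by
      rw [norm_div, Complex.norm_natCast]
      exact div_le_self (Nat.cast_nonneg _) (by linarith)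
    have hq3 : 1 / (r + 3 / 4 * δ - ‖z‖) ≤ 4 * t := by
      calc 1 / (r + 3 / 4 * δ - ‖z‖) ≤ 1 / (δ / 4) := by gcongr; linarith
        _ = 4 * (1 / δ) := by field_simp
        _ ≤ _ := by gcongr; linarith
    have hq4 : 2 * (ℓ + 1) * (r + 5 / 8 * δ) / (δ / 16) ^ 2 ≤ 512 * (ℓ + 1) * t ^ 3 := by
      calc 2 * (ℓ + 1) * (r + 5 / 8 * δ) / (δ / 16) ^ 2
          = 512 * (ℓ + 1) * ((r + 5 / 8 * δ) * (1 / δ) ^ 2) := by field_simp; ring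
        _ ≤ 512 * (ℓ + 1) * (t * t ^ 2) := by
          gcongr
          · linarith
          · linarith
        _ = _ := by ring
    have hD' : (D : ℝ) * Q ^ D ≤ D * t ^ D := by gcongr
    have hkt : (k : ℝ) ≤ 8 * t * (D * t ^ D) + 1 := by
      refine hk2.trans ?_
      gcongr
    calc ‖deriv p z / p z‖ ≤ ‖(m : ℂ) / z‖ + ‖deriv q z / q z‖ := by
          rw [hform]; exact norm_add_le _ _
      _ ≤ m + ((8 * t * (D * t ^ D) + 1) * (t + 4 * t) + 512 * (D * t ^ D + 1) * t ^ 3) := by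
          refine add_le_add hmz (hqb.trans (add_le_add ?_ (hq4.trans ?_)))
          · apply mul_le_mul hkt (add_le_add htη hq3) _ (by positivity)
            have : 0 < r + 3 / 4 * δ - ‖z‖ := by linarith
            positivity
          · gcongr
            linarith
      _ = m + 40 * D * t ^ (D + 2) + 5 * t ^ 1 + 512 * D * t ^ (D + 3) + 512 * t ^ 3 := by ring
      _ ≤ m * t ^ (D + 3) + 40 * D * t ^ (D + 3) + 5 * t ^ (D + 3) + 512 * D * t ^ (D + 3)
          + 512 * t ^ (D + 3) := by
          have : 1 ≤ t ^ (D + 3) := one_le_pow₀ ht1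
          gcongr <;> first | omega | assumption | skip
          · exact le_mul_of_one_le_right (Nat.cast_nonneg _) this
      _ = (552 * D + m + 517) * t ^ (D + 3) := by ring
      _ ≤ (552 * D + m + 1000 : ℕ) * t ^ (552 * D + m + 1000) := by
          push_cast
          gcongr <;> first | omega | norm_num

namespace PolyBoundedOff

lemma add {f g : ℂ → ℂ} (hτ : ∀ t, 0 ≤ τ t) (hf : PolyBoundedOff τ f) (hg : PolyBoundedOff τ g) :
    PolyBoundedOff τ fun z => f z + g z :=
  HoldsOff.combine hτ hf hg fun z x y B hx hy h1 h2 h3 =>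
    (norm_add_le _ _).trans (by nlinarith)

lemma mul {f g : ℂ → ℂ} (hτ : ∀ t, 0 ≤ τ t) (hf : PolyBoundedOff τ f) (hg : PolyBoundedOff τ g) :
    PolyBoundedOff τ fun z => f z * g z :=
  HoldsOff.combine hτ hf hg fun z x y B hx hy h1 h2 h3 => by
    rw [norm_mul]
    have : ‖f z‖ * ‖g z‖ ≤ x * y := by gcongr
    nlinarith

lemma const (c : ℂ) (hτ : ∀ t, 0 ≤ τ t) : PolyBoundedOff τ fun _ => c := by
  obtain ⟨N, hN⟩ := exists_nat_ge ‖c‖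
  refine ⟨N, fun r R h1 h2 h3 => ?_⟩
  have hQ := one_le_growthRatio hτ h1 h2 h3
  refine ⟨∅, by simp; positivity, fun z hz1 hz2 η hη hη1 _ => hN.trans ?_⟩
  exact le_mul_of_one_le_right (Nat.cast_nonneg _)
    (one_le_pow₀ (by rw [one_le_div hη]; linarith))

lemma congr {f g p : ℂ → ℂ} (hτ : ∀ t, 0 ≤ τ t) (hf : PolyBoundedOff τ f) (hp : ExpBounded τ p)
    (h0 : p ≠ 0) (h : ∀ z, p z ≠ 0 → f z = g z) : PolyBoundedOff τ g :=
  HoldsOff.combine hτ hf (holdsOff_logDeriv_of_expBounded hτ hp h0) fun z x y B hx hy h1 h2 h3 => by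
    rw [← h z h2.1]
    nlinarith

lemma logDeriv {p : ℂ → ℂ} (hτ : ∀ t, 0 ≤ τ t) (hp : ExpBounded τ p) (h0 : p ≠ 0) :
    PolyBoundedOff τ fun z => deriv p z / p z :=
  HoldsOff.combine hτ (const 0 hτ) (holdsOff_logDeriv_of_expBounded hτ hp h0)
    fun z x y B hx hy h1 h2 h3 => h2.2.trans (by nlinarith)

end PolyBoundedOff

end

lemma eq_zero_or_eq_zero_of_entire_mul {f g : ℂ → ℂ} (hf : Differentiable ℂ f)
    (hg : Differentiable ℂ g) (h : ∀ z, f z * g z = 0) : f = 0 ∨ g = 0 := by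
  by_contra! H
  obtain ⟨z₀, hz₀⟩ := Function.ne_iff.1 H.1
  apply H.2
  have hga : AnalyticOnNhd ℂ g Set.univ := fun z _ => hg.analyticAt z
  refine hga.eq_of_eventuallyEq (fun z _ => analyticAt_const) (z₀ := z₀) ?_
  filter_upwards [hf.continuous.continuousAt.eventually_ne hz₀] with z hz
  exact (mul_eq_zero.1 (h z)).resolve_left hz

lemma exists_eq_smul_of_wronskian_eq_zero {y w : ℂ → ℂ} (hy : Differentiable ℂ y)
    (hw : Differentiable ℂ w) (h0 : y ≠ 0) (h : ∀ z, y z * deriv w z = deriv y z * w z) :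
    ∃ a : ℂ, w = fun z => a * y z := by
  obtain ⟨z₀, hz₀⟩ := Function.ne_iff.1 h0
  obtain ⟨ε, hε, hball⟩ := Metric.eventually_nhds_iff_ball.1
    (hy.continuous.continuousAt.eventually_ne hz₀)
  refine ⟨w z₀ / y z₀, ?_⟩
  have hwa : AnalyticOnNhd ℂ w Set.univ := fun z _ => hw.analyticAt z
  refine hwa.eq_of_eventuallyEq (fun z _ => (hy.const_mul _).analyticAt z) (z₀ := z₀) ?_
  filter_upwards [ball_mem_nhds z₀ hε] with z hz
  have hd : ∀ v ∈ ball z₀ ε, HasDerivAt (fun v => w v / y v) 0 v := by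
    intro v hv
    refine ((hw v).hasDerivAt.div (hy v).hasDerivAt (hball v hv)).congr_deriv ?_
    rw [div_eq_zero_iff]
    left
    linear_combination h v
  have := (convex_ball z₀ ε).is_const_of_fderivWithin_eq_zero (𝕜 := ℂ) (f := fun v => w v / y v)
    (fun v hv => (hd v hv).differentiableAt.differentiableWithinAt)
    (fun v hv => by
      rw [fderivWithin_of_isOpen isOpen_ball hv]
      ext; simp [(hd v hv).deriv]) hz (mem_ball_self hε)
  rw [← this, div_mul_cancel₀ _ (hball z hz)]

lemma differentiable_iteratedDeriv {f : ℂ → ℂ} (hf : Differentiable ℂ f) (j : ℕ) :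
    Differentiable ℂ (iteratedDeriv j f) := by
  induction j with
  | zero => simpa using hf
  | succ j ih => rw [iteratedDeriv_succ]; exact ih.deriv

/-- The linear differential operator `x ↦ ∑_{j ≤ m} c_j x⁽ʲ⁾`. -/
noncomputable def diffOp (c : ℕ → ℂ → ℂ) (m : ℕ) (x : ℂ → ℂ) (z : ℂ) : ℂ :=
  ∑ j ∈ Finset.range (m + 1), c j z * iteratedDeriv j x z

/-- The coefficients of `x ↦ ∑_j c_j x⁽ʲ⁺¹⁾`. -/
def shiftCoeff (c : ℕ → ℂ → ℂ) : ℕ → ℂ → ℂ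
  | 0 => 0
  | j + 1 => c j

/-- The coefficients of the Wronskian of `y` and `c x`, where `c` is the operator with these coefficients. -/
noncomputable def wronskiCoeff (c : ℕ → ℂ → ℂ) (y : ℂ → ℂ) (j : ℕ) (z : ℂ) : ℂ :=
  y z * (shiftCoeff c j z + deriv (c j) z) - deriv y z * c j z

lemma differentiable_diffOp {c : ℕ → ℂ → ℂ} {x : ℂ → ℂ} (hc : ∀ j, Differentiable ℂ (c j))
    (hx : Differentiable ℂ x) (m : ℕ) : Differentiable ℂ (diffOp c m x) :=
  Differentiable.fun_sum fun j _ => (hc j).mul (differentiable_iteratedDeriv hx j)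

lemma deriv_diffOp {c : ℕ → ℂ → ℂ} {x : ℂ → ℂ} (hc : ∀ j, Differentiable ℂ (c j))
    (hx : Differentiable ℂ x) {m : ℕ} (hm : c (m + 1) = 0) (z : ℂ) :
    deriv (diffOp c m x) z = ∑ j ∈ Finset.range (m + 2),
      (shiftCoeff c j z + deriv (c j) z) * iteratedDeriv j x z := by
  have h1 : HasDerivAt (diffOp c m x) (∑ j ∈ Finset.range (m + 1),
      (deriv (c j) z * iteratedDeriv j x z + c j z * iteratedDeriv (j + 1) x z)) z := by
    refine HasDerivAt.fun_sum fun j _ => (hc j z).hasDerivAt.mul ?_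
    rw [iteratedDeriv_succ]
    exact (differentiable_iteratedDeriv hx j z).hasDerivAt
  rw [h1.deriv, Finset.sum_add_distrib]
  simp only [add_mul, Finset.sum_add_distrib]
  rw [Finset.sum_range_succ' (fun j => shiftCoeff c j z * iteratedDeriv j x z),
    Finset.sum_range_succ (fun j => deriv (c j) z * iteratedDeriv j x z) (m + 1), hm]
  simp [shiftCoeff, add_comm]

lemma diffOp_wronskiCoeff {c : ℕ → ℂ → ℂ} {x y : ℂ → ℂ} (hc : ∀ j, Differentiable ℂ (c j))
    (hx : Differentiable ℂ x) {m : ℕ} (hm : c (m + 1) = 0) (z : ℂ) :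
    diffOp (wronskiCoeff c y) (m + 1) x z =
      y z * deriv (diffOp c m x) z - deriv y z * diffOp c m x z := by
  have h1 : diffOp c m x z = ∑ j ∈ Finset.range (m + 2), c j z * iteratedDeriv j x z := by
    rw [Finset.sum_range_succ, hm]; simp [diffOp]
  rw [deriv_diffOp hc hx hm, h1, Finset.mul_sum, Finset.mul_sum, ← Finset.sum_sub_distrib]
  refine Finset.sum_congr rfl fun j _ => ?_
  simp only [wronskiCoeff]
  ring

lemma diffOp_sub_const_mul {c : ℕ → ℂ → ℂ} {x y : ℂ → ℂ} (hx : Differentiable ℂ x)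
    (hy : Differentiable ℂ y) (a : ℂ) (m : ℕ) (z : ℂ) :
    diffOp c m (x - a • y) z = diffOp c m x z - a * diffOp c m y z := by
  rw [diffOp, diffOp, diffOp, Finset.mul_sum, ← Finset.sum_sub_distrib]
  refine Finset.sum_congr rfl fun j _ => ?_
  have h1 : ContDiffAt ℂ j x z := hx.contDiff.contDiffAt
  have h2 : ContDiffAt ℂ j y z := hy.contDiff.contDiffAt
  have h3 : ContDiffAt ℂ j (a • y) z := h2.const_smul a
  rw [iteratedDeriv_sub h1 h3, iteratedDeriv_const_smul_field]
  simp only [smul_eq_mul]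
  ring

section
variable {τ : ℝ → ℝ}

lemma ExpBounded.diffOp {c : ℕ → ℂ → ℂ} {x : ℂ → ℂ} (hτ : ∀ t, 0 ≤ τ t)
    (hc : ∀ j, ExpBounded τ (c j)) (hx : ExpBounded τ x) (m : ℕ) :
    ExpBounded τ (diffOp c m x) :=
  ExpBounded.sum hτ fun j _ => (hc j).mul hτ (hx.iteratedDeriv hτ j)

lemma ExpBounded.wronskiCoeff {c : ℕ → ℂ → ℂ} {y : ℂ → ℂ} (hτ : ∀ t, 0 ≤ τ t)
    (hc : ∀ j, ExpBounded τ (c j)) (hy : ExpBounded τ y) (j : ℕ) :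
    ExpBounded τ (wronskiCoeff c y j) := by
  have h1 : ExpBounded τ (shiftCoeff c j) := by
    cases j with
    | zero => exact ExpBounded.const 0 hτ
    | succ j => exact hc j
  exact (hy.mul hτ (h1.add hτ ((hc j).deriv hτ))).sub hτ ((hy.deriv hτ).mul hτ (hc j))

lemma PolyBoundedOff.wronskiCoeff_div {c : ℕ → ℂ → ℂ} {y : ℂ → ℂ} {m : ℕ} (hτ : ∀ t, 0 ≤ τ t)
    (hc : ∀ j, ExpBounded τ (c j)) (hy : ExpBounded τ y) (hy0 : y ≠ 0) (hm : c (m + 1) = 0)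
    (hcm : c m ≠ 0) (hr : ∀ j, PolyBoundedOff τ fun z => c j z / c m z) (j : ℕ) :
    PolyBoundedOff τ fun z => wronskiCoeff c y j z / wronskiCoeff c y (m + 1) z := by
  have htop : ∀ z, wronskiCoeff c y (m + 1) z = y z * c m z := by
    intro z; simp [wronskiCoeff, shiftCoeff, hm]
  have htop0 : (fun z => y z * c m z) ≠ 0 := by
    intro h
    rcases eq_zero_or_eq_zero_of_entire_mul hy.1 (hc m).1 (congrFun h) with h | h
    exacts [hy0 h, hcm h]
  have h1 : PolyBoundedOff τ fun z => shiftCoeff c j z / c m z := by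
    cases j with
    | zero => simpa [shiftCoeff] using const 0 hτ
    | succ j => exact hr j
  have h2 : PolyBoundedOff τ fun z => deriv (c j) z / c m z := by
    by_cases h : c j = 0
    · simpa [h] using const 0 hτ
    · refine ((logDeriv hτ (hc j) h).mul hτ (hr j)).congr hτ (hc j) h fun z hz => ?_
      field_simp
  have h3 := (const (-1) hτ).mul hτ ((logDeriv hτ hy hy0).mul hτ (hr j))
  refine ((h1.add hτ h2).add hτ h3).congr hτ (hy.mul hτ (hc m)) htop0 fun z hz => ?_
  have hyz := left_ne_zero_of_mul hz
  have hcz := right_ne_zero_of_mul hz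
  rw [htop, wronskiCoeff]
  field_simp
  ring

theorem exists_diffOp_of_linearIndependent {F : ℕ → ℂ → ℂ} {n : ℕ} (hτ : ∀ t, 0 ≤ τ t)
    (hF : ∀ k < n, ExpBounded τ (F k))
    (hind : ∀ m < n, F m ∉ Submodule.span ℂ (F '' {k | k < m})) : ∀ m ≤ n, ∃ c : ℕ → ℂ → ℂ,
      (∀ j, ExpBounded τ (c j)) ∧ (∀ j, m < j → c j = 0) ∧ c m ≠ 0 ∧
      (∀ j, PolyBoundedOff τ fun z => c j z / c m z) ∧
      (∀ k < m, ∀ z, diffOp c m (F k) z = 0) ∧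
      (∀ x : ℂ → ℂ, Differentiable ℂ x → (∀ z, diffOp c m x z = 0) →
        x ∈ Submodule.span ℂ (F '' {k | k < m})) ∧
      ∀ a : ℕ → ℂ → ℂ, (∀ j, Differentiable ℂ (a j)) →
        (∀ k < m, ∀ z, ∑ j ∈ Finset.range m, a j z * iteratedDeriv j (F k) z = 0) →
        ∀ j < m, a j = 0 := by
  intro m
  induction m with
  | zero =>
    intro _
    refine ⟨fun j => if j = 0 then 1 else 0, fun j => ?_, fun j hj => if_neg hj.ne', by simp,
      fun j => ?_, by simp, fun x _ hx0 => ?_, by simp⟩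
    · dsimp only
      split_ifs
      exacts [ExpBounded.const 1 hτ, ExpBounded.const 0 hτ]
    · by_cases h : j = 0
      · simpa [h] using PolyBoundedOff.const 1 hτ
      · simpa [h] using PolyBoundedOff.const 0 hτ
    · have : x = 0 := by
        ext z; simpa [diffOp] using hx0 z
      rw [this]; exact zero_mem _
  | succ m ih =>
    intro hmn
    obtain ⟨c, hc, hc0, hcm, hr, hk, hker, huniq⟩ := ih (by omega)
    have hcd : ∀ j, Differentiable ℂ (c j) := fun j => (hc j).1
    have hc1 : c (m + 1) = 0 := hc0 _ (by omega)
    have hFm := hF m (by omega)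
    set y := diffOp c m (F m) with hy
    have hyE : ExpBounded τ y := ExpBounded.diffOp hτ hc hFm m
    have hy0 : y ≠ 0 := fun h => hind m (by omega) (hker _ hFm.1 (congrFun h))
    refine ⟨wronskiCoeff c y, fun j => ExpBounded.wronskiCoeff hτ hc hyE j, fun j hj => ?_, ?_,
      fun j => PolyBoundedOff.wronskiCoeff_div hτ hc hyE hy0 hc1 hcm hr j, fun k hkm z => ?_,
      fun x hx hx0 => ?_, fun a ha hak => ?_⟩
    · obtain ⟨i, rfl⟩ : ∃ i, j = i + 1 := ⟨j - 1, by omega⟩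
      ext z
      simp [wronskiCoeff, shiftCoeff, hc0 (i + 1) (by omega), hc0 i (by omega)]
    · intro h
      rcases eq_zero_or_eq_zero_of_entire_mul hyE.1 (hcd m) (fun z => by
        have := congrFun h z
        simpa [wronskiCoeff, shiftCoeff, hc1] using this) with h | h
      exacts [hy0 h, hcm h]
    · rw [diffOp_wronskiCoeff hcd (hF k (by omega)).1 hc1]
      rcases Nat.lt_succ_iff_lt_or_eq.1 hkm with h | rfl
      · have : diffOp c m (F k) = 0 := funext (hk k h)
        rw [this]; simp
      · rw [← hy]; ring
    · obtain ⟨b, hb⟩ := exists_eq_smul_of_wronskian_eq_zero hyE.1 (differentiable_diffOp hcd hx m)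
        hy0 (fun z => by
          have := hx0 z
          rw [diffOp_wronskiCoeff hcd hx hc1] at this
          exact sub_eq_zero.1 this)
      have h1 := hker (x - b • F m) (hx.sub (hFm.1.const_smul b)) (fun z => by
        rw [diffOp_sub_const_mul hx hFm.1, congrFun hb z, ← hy, sub_self])
      have h2 : Submodule.span ℂ (F '' {k | k < m}) ≤ Submodule.span ℂ (F '' {k | k < m + 1}) :=
        Submodule.span_mono (Set.image_mono fun k (hk : k < m) => Nat.lt_succ_of_lt hk)
      have h3 : F m ∈ Submodule.span ℂ (F '' {k | k < m + 1}) :=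
        Submodule.subset_span ⟨m, Nat.lt_succ_self m, rfl⟩
      simpa using add_mem (h2 h1) (Submodule.smul_mem _ b h3)
    · have hsum : ∀ k z, ∑ j ∈ Finset.range m, (c m z * a j z - a m z * c j z) *
          iteratedDeriv j (F k) z =
          c m z * (∑ j ∈ Finset.range (m + 1), a j z * iteratedDeriv j (F k) z)
            - a m z * diffOp c m (F k) z := by
        intro k z
        rw [diffOp, Finset.sum_range_succ, Finset.sum_range_succ, mul_add, mul_add, Finset.mul_sum,
          Finset.mul_sum]
        simp only [sub_mul, Finset.sum_sub_distrib, mul_assoc]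
        ring
      have hb := huniq (fun j z => c m z * a j z - a m z * c j z)
        (fun j => ((hcd m).mul (ha j)).sub ((ha m).mul (hcd j)))
        (fun k hkm z => by
          rw [hsum, hak k (by omega) z, hk k hkm z]; ring)
      have ham : a m = 0 := by
        refine (eq_zero_or_eq_zero_of_entire_mul (ha m) hyE.1 fun z => ?_).resolve_right hy0
        have h1 := hsum m z
        rw [hak m (by omega) z, ← hy, Finset.sum_eq_zero fun j hj => by
          rw [congrFun (hb j (Finset.mem_range.1 hj)) z]; simp] at h1
        linear_combination h1
      intro j hj
      rcases Nat.lt_succ_iff_lt_or_eq.1 hj with h | rfl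
      · refine (eq_zero_or_eq_zero_of_entire_mul (hcd m) (ha j) fun z => ?_).resolve_left hcm
        simpa [ham] using congrFun (hb j h) z
      · exact ham

theorem polyBoundedOff_coeff {F A : ℕ → ℂ → ℂ} {n : ℕ} (hτ : ∀ t, 0 ≤ τ t)
    (hF : ∀ k < n, ExpBounded τ (F k))
    (hind : ∀ m < n, F m ∉ Submodule.span ℂ (F '' {k | k < m})) (hA : ∀ j, Differentiable ℂ (A j))
    (hsol : ∀ k < n, ∀ z, iteratedDeriv n (F k) z +
      ∑ j ∈ Finset.range n, A j z * iteratedDeriv j (F k) z = 0) :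
    ∀ j < n, PolyBoundedOff τ (A j) := by
  obtain ⟨c, hc, -, hcn, hr, hk, -, huniq⟩ :=
    exists_diffOp_of_linearIndependent hτ hF hind n le_rfl
  have hb := huniq (fun j z => c n z * A j z - c j z)
    (fun j => ((hc n).1.mul (hA j)).sub (hc j).1)
    (fun k hkn z => by
      have h1 := hk k hkn z
      have h2 := hsol k hkn z
      rw [diffOp, Finset.sum_range_succ] at h1
      simp only [sub_mul, Finset.sum_sub_distrib, mul_assoc, ← Finset.mul_sum]
      linear_combination c n z * h2 - h1)
  intro j hj
  refine (hr j).congr hτ (hc n) hcn fun z hz => ?_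
  have := congrFun (hb j hj) z
  simp only [Pi.zero_apply] at this
  rw [div_eq_iff hz]
  linear_combination -this

end

section Borel

lemma volume_growth_exceptional_lt_top {u : ℝ → ℝ} (h1 : ∀ r, 1 ≤ u r)
    (hu : MonotoneOn u (Set.Ici 1)) :
    volume {r | 1 ≤ r ∧ 2 * u r < u (r + 1 / u r)} < ⊤ := by
  set E := {r | 1 ≤ r ∧ 2 * u r < u (r + 1 / u r)}
  have hdist : ∀ (k : ℕ), ∀ r ∈ E, ∀ s ∈ E, 2 ^ k ≤ u r → u s < 2 ^ (k + 1) →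
      s - r ≤ (1 / 2) ^ k := by
    intro k r hr s hs hrk hsk
    by_contra! h
    have h2 : 1 / u r ≤ (1 / 2) ^ k := by
      rw [one_div_pow]; gcongr
    have h3 : 0 < 1 / u r := by have := h1 r; positivity
    have hr1 : 1 ≤ r := hr.1
    have h4 : u (r + 1 / u r) ≤ u s :=
      hu (by simp only [Set.mem_Ici]; linarith) hs.1 (by linarith)
    have h5 := hr.2
    rw [pow_succ] at hsk
    linarith
  have hcover : E ⊆ ⋃ k : ℕ, {r | r ∈ E ∧ 2 ^ k ≤ u r ∧ u r < 2 ^ (k + 1)} := by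
    intro r hr
    obtain ⟨k, hk1, hk2⟩ := exists_nat_pow_near (h1 r) one_lt_two
    exact Set.mem_iUnion.2 ⟨k, hr, hk1, hk2⟩
  calc volume E ≤ ∑' k : ℕ, ENNReal.ofReal ((1 / 2) ^ k) := by
        refine (measure_mono hcover).trans ((measure_iUnion_le _).trans ?_)
        refine ENNReal.tsum_le_tsum fun k => (Real.volume_le_diam _).trans ?_
        refine Metric.ediam_le fun r hr s hs => ?_
        rw [edist_dist, Real.dist_eq]
        refine ENNReal.ofReal_le_ofReal (abs_sub_le_iff.2 ⟨?_, ?_⟩)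
        · exact hdist k s hs.1 r hr.1 hs.2.1 hr.2.2
        · exact hdist k r hr.1 s hs.1 hr.2.1 hs.2.2
    _ < ⊤ := by
        rw [← ENNReal.ofReal_tsum_of_nonneg (fun k => by positivity) summable_geometric_two]
        exact ENNReal.ofReal_lt_top

lemma exists_mem_Icc_forall_le_abs_sub (s : Finset ℝ) {r L : ℝ} (hL : 0 < L) :
    ∃ ρ ∈ Set.Icc r (r + L), ∀ a ∈ s, L / (2 * (s.card + 1)) ≤ |ρ - a| := by
  by_contra! h
  set d := L / (s.card + 1) with hd
  have hd0 : 0 < d := by positivity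
  have hd2 : L / (2 * (s.card + 1)) = d / 2 := by rw [hd]; field_simp
  have hmem : ∀ i ∈ Finset.range (s.card + 1), ∃ a ∈ s, |r + d * i - a| < d / 2 := by
    intro i hi
    rw [← hd2]
    refine h _ ⟨by have : 0 ≤ d * i := by positivity
                   linarith, ?_⟩
    have hi' : (i : ℝ) ≤ s.card + 1 := by exact_mod_cast (Finset.mem_range.1 hi).le
    have : d * i ≤ d * (s.card + 1) := by gcongr
    have h3 : d * (s.card + 1) = L := by rw [hd]; field_simp
    linarith
  choose! g hg hgd using hmem
  obtain ⟨i, hi, j, hj, hij, hgij⟩ := Finset.exists_ne_map_eq_of_card_lt_of_maps_to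
    (s := Finset.range (s.card + 1)) (t := s) (by simp) hg
  have h1 := hgd i hi
  have h2 := hgd j hj
  rw [hgij] at h1
  have h3 : |d * i - d * j| < d := by
    have := abs_sub (r + d * i - g j) (r + d * j - g j)
    rw [show d * i - d * j = (r + d * i - g j) - (r + d * j - g j) by ring]
    linarith
  rw [← mul_sub, abs_mul, abs_of_pos hd0] at h3
  have h4 : |(i : ℝ) - j| < 1 := by
    by_contra! h
    nlinarith
  have h5 : |(i : ℤ) - j| < 1 := by exact_mod_cast h4
  rw [Int.abs_lt_one_iff] at h5
  omega

lemma PolyBoundedOff.exists_norm_le {τ : ℝ → ℝ} {g : ℂ → ℂ} (hτ : ∀ t, 0 ≤ τ t)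
    (hg : Differentiable ℂ g) (h : PolyBoundedOff τ g) :
    ∃ D : ℕ, ∀ r R : ℝ, 1 ≤ r → r < R → R ≤ r + 1 → ∀ z : ℂ, ‖z‖ ≤ r →
      ‖g z‖ ≤ D * growthRatio τ r R ^ D := by
  obtain ⟨C, hC⟩ := h
  refine ⟨C * (4 * (C + 1)) ^ C + (C + 2) * C, fun r R h1 h2 h3 z hz => ?_⟩
  obtain ⟨s, hs, hb⟩ := hC r R h1 h2 h3
  have hQ := one_le_growthRatio hτ h1 h2 h3
  have hQ2 := one_div_sub_le_growthRatio hτ h1 h2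
  set Q := growthRatio τ r R
  obtain ⟨ρ, hρ, hρs⟩ := exists_mem_Icc_forall_le_abs_sub s (r := r) (L := (R - r) / 2)
    (by linarith)
  set η := (R - r) / 2 / (2 * (s.card + 1)) with hη
  have hRr : 0 < R - r := by linarith
  have hη0 : 0 < η := by positivity
  have hη1 : η ≤ 1 := by
    rw [hη, div_le_one (by positivity)]
    have : (0 : ℝ) ≤ s.card := by positivity
    linarith
  have hQη : Q / η ≤ 4 * (C + 1) * Q ^ (C + 2) := by
    have e : Q / η = 4 * (s.card + 1) * Q * (1 / (R - r)) := by
      rw [hη]; field_simp; ring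
    have h4 : (s.card : ℝ) + 1 ≤ (C + 1) * Q ^ C := by
      have := one_le_pow₀ hQ (n := C)
      linarith
    calc Q / η ≤ 4 * ((C + 1) * Q ^ C) * Q * Q := by rw [e]; gcongr
      _ = _ := by ring
  have hρ' : ∀ w : ℂ, ‖w‖ = ρ → ‖g w‖ ≤ C * (Q / η) ^ C := fun w hw =>
    hb w (by rw [hw]; exact hρ.1) (by rw [hw]; linarith [hρ.2]) η hη0 hη1
      (by rw [hw]; exact hρs)
  refine (norm_le_of_forall_sphere (by linarith [hρ.1]) hg hρ' (hz.trans hρ.1)).trans ?_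
  calc (C : ℝ) * (Q / η) ^ C ≤ C * (4 * (C + 1) * Q ^ (C + 2)) ^ C := by gcongr
    _ = (C * (4 * (C + 1)) ^ C) * Q ^ ((C + 2) * C) := by rw [mul_pow, ← pow_mul]; ring
    _ ≤ _ := by
      push_cast
      have : (0 : ℝ) ≤ (C + 2) * C := by positivity
      gcongr
      · linarith
      · exact Nat.le_add_left _ _

end Borel

section Comparison

lemma monotoneOn_proximity_top {f : ℂ → ℂ} (hf : Differentiable ℂ f) :
    MonotoneOn (ValueDistribution.proximity f ⊤) (Set.Ioi 0) := by
  have ha : AnalyticOnNhd ℂ f Set.univ := fun z _ => hf.analyticAt z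
  have h1 : ValueDistribution.logCounting f ⊤ = 0 := by
    rw [ValueDistribution.logCounting_top,
      negPart_eq_zero.2 (MeromorphicOn.AnalyticOnNhd.divisor_nonneg ha), map_zero]
  have h2 := ValueDistribution.characteristic_monotoneOn (f := f)
    (fun z => (hf.analyticAt z).meromorphicAt)
  rwa [ValueDistribution.characteristic, h1, add_zero] at h2

lemma posLog_const_mul_le_log_sqrt {K x y : ℝ} (hK : 1 ≤ K) (hx : 0 ≤ x) (hy : x ^ 2 ≤ y) :
    Real.posLog (K * x) ≤ K ^ 2 * Real.log (Real.sqrt (1 + y)) := by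
  have hy0 : 0 ≤ y := (sq_nonneg x).trans hy
  rw [Real.log_sqrt (by linarith)]
  have h0 : 0 ≤ Real.log (1 + y) := Real.log_nonneg (by linarith)
  rw [Real.posLog]
  refine max_le (by positivity) ?_
  rcases eq_or_lt_of_le hx with h | h
  · rw [← h]; simp; positivity
  have h1 : 1 + K ^ 2 * y ≤ (1 + y) ^ (K ^ 2) :=
    one_add_mul_self_le_rpow_one_add (by linarith) (one_le_pow₀ hK)
  have h2 : (K * x) ^ 2 ≤ (1 + y) ^ (K ^ 2) := by
    rw [mul_pow]
    have := mul_le_mul_of_nonneg_left hy (sq_nonneg K)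
    linarith
  have h3 := Real.log_le_log (by positivity) h2
  rw [Real.log_pow, Real.log_rpow (by linarith)] at h3
  push_cast at h3
  linarith

lemma proximity_const_mul_le_charFn {n : ℕ} {F : Fin n → ℂ → ℂ} (hF : ∀ k, Continuous (F k))
    (k : Fin n) {K : ℝ} (hK : 1 ≤ K) (r : ℝ) :
    ValueDistribution.proximity (fun z => (K : ℂ) * F k z) ⊤ r ≤ K ^ 2 * charFn n F r := by
  have hc : ∀ θ, circlePt r θ = circleMap 0 r θ := fun θ => by simp [circlePt, circleMap]
  rw [ValueDistribution.proximity_top, Real.circleAverage_def, charFn, smul_eq_mul, ← one_div,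
    mul_left_comm (K ^ 2)]
  simp only [hc]
  rw [← intervalIntegral.integral_const_mul (K ^ 2)]
  refine mul_le_mul_of_nonneg_left (intervalIntegral.integral_mono_on (by positivity) ?_ ?_ ?_)
    (by positivity)
  · apply Continuous.intervalIntegrable
    have := hF k
    fun_prop
  · apply Continuous.intervalIntegrable
    have h1 : Continuous fun θ => Real.sqrt (1 + ∑ k : Fin n, ‖F k (circleMap 0 r θ)‖ ^ 2) := by
      fun_prop
    refine continuous_const.mul (h1.log fun θ => ?_)
    positivity
  · intro θ _
    rw [norm_mul, Complex.norm_real, Real.norm_of_nonneg (by linarith)]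
    refine posLog_const_mul_le_log_sqrt hK (norm_nonneg _) ?_
    exact Finset.single_le_sum (f := fun k => ‖F k (circleMap 0 r θ)‖ ^ 2)
      (fun i _ => by positivity) (Finset.mem_univ k)

lemma exists_pos_le_charFn {n : ℕ} {F : Fin n → ℂ → ℂ} (hF : ∀ k, Differentiable ℂ (F k))
    {k : Fin n} (hk : F k ≠ 0) : ∃ c > 0, ∀ᶠ r in atTop, c ≤ charFn n F r := by
  obtain ⟨z, hz⟩ := Function.ne_iff.1 hk
  have hz' : 0 < ‖F k z‖ := norm_pos_iff.2 hz
  set K := 1 + 1 / ‖F k z‖ with hKd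
  have hK : 1 ≤ K := by
    have : 0 < 1 / ‖F k z‖ := by positivity
    linarith
  have hd : Differentiable ℂ fun w => (K : ℂ) * F k w := (hF k).const_mul _
  have h1 := posLog_norm_le_mul_proximity hd (w := z) (R := ‖z‖ + 1) (by linarith)
  have h2 : 0 < Real.posLog ‖(K : ℂ) * F k z‖ := by
    rw [Real.posLog]
    refine lt_max_of_lt_right (Real.log_pos ?_)
    rw [norm_mul, Complex.norm_real, Real.norm_of_nonneg (by linarith), hKd, add_mul,
      one_div_mul_cancel hz'.ne']
    linarith
  set p := ValueDistribution.proximity (fun w => (K : ℂ) * F k w) ⊤ with hp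
  have h3 : 0 < p (‖z‖ + 1) := pos_of_mul_pos_right (h2.trans_le h1) (by
    have := norm_nonneg z
    exact div_nonneg (by linarith) (by linarith))
  refine ⟨p (‖z‖ + 1) / K ^ 2, by positivity, ?_⟩
  filter_upwards [eventually_ge_atTop (‖z‖ + 1)] with r hr
  have h4 : (0 : ℝ) < ‖z‖ + 1 := by positivity
  rw [div_le_iff₀' (by positivity)]
  exact (monotoneOn_proximity_top hd h4 (h4.trans_le hr) hr).trans
    (proximity_const_mul_le_charFn (fun k => (hF k).continuous) k hK r)

end Comparison

lemma expBounded_of_proximity_le {τ : ℝ → ℝ} {f : ℂ → ℂ} (hτ : ∀ t, 0 ≤ τ t)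
    (hf : Differentiable ℂ f) (h : ∀ R, ValueDistribution.proximity f ⊤ R ≤ τ R) :
    ExpBounded τ f := by
  refine ⟨hf, 2, fun r R h1 h2 h3 z hz => ?_⟩
  have hQ := one_le_growthRatio hτ h1 h2 h3
  have hp := posLog_norm_le_mul_proximity hf (hz.trans_lt h2)
  have hp0 : 0 ≤ ValueDistribution.proximity f ⊤ R := ValueDistribution.proximity_nonneg R
  have h4 : (R + ‖z‖) / (R - ‖z‖) * ValueDistribution.proximity f ⊤ R ≤
      2 * R / (R - r) * (1 + τ R) := by
    have h5 := h R
    have h6 := norm_nonneg z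
    have h7 : 0 < R - r := by linarith
    refine mul_le_mul (div_le_div₀ (by linarith) (by linarith) h7 (by linarith)) (by linarith)
      hp0 (div_nonneg (by linarith) h7.le)
  have h5 : 2 * R / (R - r) * (1 + τ R) = 2 * growthRatio τ r R := by
    rw [growthRatio]; ring
  have h6 : growthRatio τ r R ≤ growthRatio τ r R ^ 2 := le_self_pow₀ hQ two_ne_zero
  rcases eq_or_lt_of_le (norm_nonneg (f z)) with h0 | h0
  · rw [← h0]; positivity
  · rw [← Real.log_le_iff_le_exp h0]
    have : Real.log ‖f z‖ ≤ Real.posLog ‖f z‖ := le_max_right _ _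
    push_cast
    linarith

lemma Linf_le {f : ℂ → ℂ} {r B : ℝ} (hr : 0 ≤ r) (hB : 0 ≤ B)
    (h : ∀ z : ℂ, ‖z‖ = r → Real.log ‖f z‖ ≤ B) : Linf f r ≤ B := by
  refine csSup_le ((NormedSpace.sphere_nonempty.2 hr).image _) ?_
  rintro _ ⟨z, hz, rfl⟩
  exact max_le (h z (mem_sphere_zero_iff_norm.1 hz)) hB

/-- Coefficients of a linear differential equation with solution base `F` are polynomially bounded
in terms of the growth ratio of the proximity functions of `F`. -/
lemma exists_norm_coeff_le {n : ℕ} {A F : Fin n → ℂ → ℂ} {τ : ℝ → ℝ} (hτ : ∀ t, 0 ≤ τ t)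
    (hA : ∀ j, Differentiable ℂ (A j)) (hF : ∀ k, ExpBounded τ (F k))
    (hlin : LinearIndependent ℂ F) (hsol : ∀ k, IsSolutionE n A (F k)) (j : Fin n) :
    ∃ D : ℕ, ∀ r R : ℝ, 1 ≤ r → r < R → R ≤ r + 1 → ∀ z : ℂ, ‖z‖ ≤ r →
      ‖A j z‖ ≤ D * growthRatio τ r R ^ D := by
  set A' : ℕ → ℂ → ℂ := fun j => if h : j < n then A ⟨j, h⟩ else 0 with hA'
  set F' : ℕ → ℂ → ℂ := fun j => if h : j < n then F ⟨j, h⟩ else 0 with hF'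
  have eA : ∀ j : Fin n, A' j = A j := fun j => by simp [hA']
  have eF : ∀ k : Fin n, F' k = F k := fun k => by simp [hF']
  have key := polyBoundedOff_coeff (τ := τ) (F := F') (A := A') (n := n) hτ
    (fun k hk => by rw [show F' k = F ⟨k, hk⟩ from eF ⟨k, hk⟩]; exact hF _)
    (fun m hm => by
      have h1 := hlin.notMem_span_image (s := {k : Fin n | (k : ℕ) < m}) (x := ⟨m, hm⟩) (by simp)
      rw [show F' m = F ⟨m, hm⟩ from eF ⟨m, hm⟩]
      convert h1 using 4
      ext x
      constructor
      · rintro ⟨k, hk, rfl⟩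
        exact ⟨⟨k, lt_trans hk hm⟩, hk, (eF ⟨k, lt_trans hk hm⟩).symm⟩
      · rintro ⟨k, hk, rfl⟩
        exact ⟨k, hk, eF k⟩)
    (fun j => by
      by_cases h : j < n
      · rw [show A' j = A ⟨j, h⟩ from eA ⟨j, h⟩]; exact hA _
      · simp only [hA', h, dif_neg, not_false_eq_true]; exact differentiable_const 0)
    (fun k hk z => by
      rw [show F' k = F ⟨k, hk⟩ from eF ⟨k, hk⟩, Finset.sum_range]
      simp only [eA]
      exact (hsol _).2 z)
    j j.2
  rw [eA] at key
  exact key.exists_norm_le hτ (hA j)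

/-- remark after Lemma 4.5: with entire coefficients and a solution base with
characteristic `T(r)`, there is a set `E` of finite linear measure with
`L(r,∞,A_j) = O(log r + log T(r))` for `r ∉ E` and every `j`. -/
theorem coefficient_bound_from_characteristic
    {n : ℕ} (A : Fin n → ℂ → ℂ) (hA : ∀ j, Differentiable ℂ (A j))
    (F : Fin n → ℂ → ℂ) (hF : IsSolutionBase n A F) :
    ∃ E : Set ℝ, FiniteLinearMeasure E ∧ ∃ C : ℝ, ∀ j : Fin n,
      ∀ᶠ r in Filter.atTop, r ∉ E →
        Linf (A j) r ≤ C * (Real.log r + Real.log (charFn n F r)) := by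
  obtain ⟨hsol, hlin, -⟩ := hF
  have hFd : ∀ k, Differentiable ℂ (F k) := fun k => (hsol k).1
  set τ : ℝ → ℝ := fun R => ∑ k, ValueDistribution.proximity (F k) ⊤ R with hτd
  have hp0 : ∀ k R, 0 ≤ ValueDistribution.proximity (F k) ⊤ R := fun k R =>
    ValueDistribution.proximity_nonneg R
  have hτ : ∀ t, 0 ≤ τ t := fun t => Finset.sum_nonneg fun k _ => hp0 k t
  set u : ℝ → ℝ := fun R => 1 + τ R with hu
  have hu1 : ∀ r, 1 ≤ u r := fun r => by simpa [hu] using hτ r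
  have humono : MonotoneOn u (Set.Ici 1) := by
    intro a ha b hb hab
    have h : ∀ k, ValueDistribution.proximity (F k) ⊤ a ≤ ValueDistribution.proximity (F k) ⊤ b :=
      fun k => monotoneOn_proximity_top (hFd k) (zero_lt_one.trans_le (Set.mem_Ici.1 ha))
        (zero_lt_one.trans_le (Set.mem_Ici.1 hb)) hab
    simp only [hu, hτd]
    gcongr with k
    exact h k
  have hFE : ∀ k, ExpBounded τ (F k) := fun k => expBounded_of_proximity_le hτ (hFd k) fun R =>
    Finset.single_le_sum (f := fun k => ValueDistribution.proximity (F k) ⊤ R)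
      (fun i _ => hp0 i R) (Finset.mem_univ k)
  choose D hD using exists_norm_coeff_le hτ hA hFE hlin hsol
  set N : ℕ := ∑ j, D j + 1 with hN
  refine ⟨{r | 1 ≤ r ∧ 2 * u r < u (r + 1 / u r)}, volume_growth_exceptional_lt_top hu1 humono,
    2 * N + 1, fun j => ?_⟩
  obtain ⟨c, hc, hcT⟩ := exists_pos_le_charFn hFd (hlin.ne_zero j)
  have hDN : D j ≤ N := (Finset.single_le_sum (f := D) (fun i _ => Nat.zero_le _)
    (Finset.mem_univ j)).trans (Nat.le_succ _)
  have hN1 : (1 : ℝ) ≤ N := by rw [hN]; exact_mod_cast Nat.le_add_left 1 _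
  set b : ℝ := 1 / c + n with hb
  have hb0 : 0 < b := by positivity
  filter_upwards [hcT, eventually_ge_atTop 1, Real.tendsto_log_atTop.eventually_ge_atTop
    (|Real.log N + N * (Real.log 4 + 2 * Real.log b)| - Real.log c)] with r hT hr1 hlr hrE
  have hT0 : 0 < charFn n F r := hc.trans_le hT
  have hlogr : 0 ≤ Real.log r := Real.log_nonneg hr1
  have hlogT : Real.log c ≤ Real.log (charFn n F r) := Real.log_le_log hc hT
  have hub : u r ≤ b * charFn n F r := by
    have h1 : τ r ≤ n * charFn n F r := by
      have : τ r ≤ ∑ _k : Fin n, charFn n F r := Finset.sum_le_sum fun k _ => by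
        simpa using proximity_const_mul_le_charFn (fun k => (hFd k).continuous) k le_rfl r
      simpa using this
    have h2 : 1 ≤ 1 / c * charFn n F r := by
      rw [one_div_mul_eq_div, one_le_div hc]; exact hT
    simp only [hu, hb]
    linarith
  have hu0 : 0 < u r := zero_lt_one.trans_le (hu1 r)
  have hlogu : Real.log (u r) ≤ Real.log b + Real.log (charFn n F r) := by
    rw [← Real.log_mul hb0.ne' hT0.ne']
    exact Real.log_le_log hu0 hub
  have hur : 0 < 1 / u r := by positivity
  have hur1 : 1 / u r ≤ 1 := (div_le_one hu0).2 (hu1 r)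
  have hQ : growthRatio τ r (r + 1 / u r) ≤ 4 * r * u r ^ 2 := by
    have h1 : u (r + 1 / u r) ≤ 2 * u r := by
      by_contra! h
      exact hrE ⟨hr1, h⟩
    have h2 : growthRatio τ r (r + 1 / u r) = (r + 1 / u r) * u (r + 1 / u r) * u r := by
      rw [growthRatio, add_sub_cancel_left, div_div_eq_mul_div, div_one]
    rw [h2]
    calc (r + 1 / u r) * u (r + 1 / u r) * u r ≤ (r + r) * (2 * u r) * u r := by
          have := hu1 (r + 1 / u r)
          gcongr
          linarith
      _ = _ := by ring
  have hQ0 : 1 ≤ growthRatio τ r (r + 1 / u r) :=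
    one_le_growthRatio hτ hr1 (by linarith) (by linarith)
  have hlogQ : Real.log (growthRatio τ r (r + 1 / u r)) ≤
      Real.log 4 + Real.log r + 2 * Real.log (u r) := by
    refine (Real.log_le_log (by linarith) hQ).trans_eq ?_
    rw [Real.log_mul (by positivity) (by positivity), Real.log_mul (by norm_num) (by positivity),
      Real.log_pow]
    push_cast; ring
  have hpos : |Real.log N + N * (Real.log 4 + 2 * Real.log b)| ≤
      Real.log r + Real.log (charFn n F r) := by linarith
  have hpos0 := (abs_nonneg _).trans hpos
  have hpos1 := (le_abs_self _).trans hpos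
  refine Linf_le (by linarith) (by positivity) fun z hz => ?_
  rcases eq_or_ne (A j z) 0 with h0 | h0
  · rw [h0, norm_zero, Real.log_zero]; positivity
  have h1 : ‖A j z‖ ≤ N * growthRatio τ r (r + 1 / u r) ^ N :=
    (hD j r (r + 1 / u r) hr1 (by linarith) (by linarith) z hz.le).trans
      (natCast_mul_pow_le hQ0 hDN)
  have h2 := Real.log_le_log (norm_pos_iff.2 h0) h1
  rw [Real.log_mul (by positivity) (by positivity), Real.log_pow] at h2
  have h3 : (N : ℝ) * Real.log (growthRatio τ r (r + 1 / u r)) ≤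
      N * (Real.log 4 + Real.log r + 2 * (Real.log b + Real.log (charFn n F r))) := by
    gcongr
    linarith
  have h4 : 0 ≤ N * Real.log r := by positivity
  nlinarith
end

section
/- The functions f₁(z) = 1 + e^z and f₂(z) = exp(z + e^{−z}) are linearly independent solutions of the equation f'' + e^{−z}f' − f = 0; moreover, the solution f₁ satisfies δ_N(1,f₁) = 1 and δ_P(1,f₁) = π. -/
open MeasureTheory Filter Metric

/-- The function `1 + eᶻ`. -/
noncomputable def onePlusExp (z : ℂ) : ℂ := 1 + Complex.exp z

/-- The spherical area form pulled back by `f`, as a measure on `ℂ`. -/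
noncomputable def sphMeasure (f : ℂ → ℂ) : Measure ℂ :=
  volume.withDensity fun z => ENNReal.ofReal (sphDeriv f z ^ 2)

/-- The `k`-th period rectangle of the exponential function, truncated at `|Re z| < R`. -/
def periodRect (k : ℤ) (R : ℝ) : Set ℂ :=
  {z | |z.re| < R ∧ z.im ∈ Set.Ioc ((2 * k - 1) * Real.pi) ((2 * k + 1) * Real.pi)}

/-- The period strip `-π < Im z ≤ π` of the exponential function. -/
noncomputable def periodStrip : Set ℂ := {z | z.im ∈ Set.Ioc (-Real.pi) Real.pi}

theorem deriv_onePlusExp : deriv onePlusExp = Complex.exp := by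
  ext z
  exact ((Complex.hasDerivAt_exp z).const_add 1).deriv

theorem sphDeriv_onePlusExp (z : ℂ) :
    sphDeriv onePlusExp z = ‖Complex.exp z‖ / (1 + ‖1 + Complex.exp z‖ ^ 2) := by
  rw [sphDeriv, deriv_onePlusExp, onePlusExp]

theorem continuous_sphDeriv_onePlusExp : Continuous (sphDeriv onePlusExp) := by
  rw [show sphDeriv onePlusExp = _ from funext sphDeriv_onePlusExp]
  refine Continuous.div (by fun_prop) (by fun_prop) fun z => by positivity

theorem sphDeriv_onePlusExp_nonneg (z : ℂ) : 0 ≤ sphDeriv onePlusExp z := by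
  rw [sphDeriv_onePlusExp]
  positivity

theorem sphDeriv_onePlusExp_le (z : ℂ) : sphDeriv onePlusExp z ≤ 2 := by
  rw [sphDeriv_onePlusExp, div_le_iff₀ (by positivity)]
  have h : ‖Complex.exp z‖ ≤ ‖1 + Complex.exp z‖ + 1 := by
    calc ‖Complex.exp z‖ = ‖(1 + Complex.exp z) - 1‖ := by ring_nf
      _ ≤ ‖1 + Complex.exp z‖ + ‖(1 : ℂ)‖ := norm_sub_le _ _
      _ = _ := by simp
  nlinarith [sq_nonneg (‖1 + Complex.exp z‖ - 1)]

theorem sphDeriv_onePlusExp_add_period (k : ℤ) (z : ℂ) :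
    sphDeriv onePlusExp (z + k * (2 * Real.pi * Complex.I)) = sphDeriv onePlusExp z := by
  simp only [sphDeriv_onePlusExp, Complex.exp_periodic.int_mul k z]

theorem sphArea_onePlusExp (r : ℝ) :
    sphArea onePlusExp r = 1 / Real.pi * (sphMeasure onePlusExp (ball 0 r)).toReal := by
  rw [sphArea, sphMeasure, withDensity_apply _ measurableSet_ball,
    integral_eq_lintegral_of_nonneg_ae (ae_of_all _ fun z => sq_nonneg _)
      (continuous_sphDeriv_onePlusExp.pow 2).aestronglyMeasurable]

theorem measurableSet_periodRect (k : ℤ) (R : ℝ) : MeasurableSet (periodRect k R) := by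
  unfold periodRect
  measurability

theorem measurableSet_periodStrip : MeasurableSet periodStrip := by
  unfold periodStrip
  measurability

theorem sphMeasure_periodRect (k : ℤ) (R : ℝ) :
    sphMeasure onePlusExp (periodRect k R) = sphMeasure onePlusExp (periodRect 0 R) := by
  set T : ℂ := k * (2 * Real.pi * Complex.I) with hT
  have hpre : (fun z => z + T) ⁻¹' periodRect k R = periodRect 0 R := by
    ext z
    have h1 : (z + T).re = z.re := by simp [hT]
    have h2 : (z + T).im = z.im + k * (2 * Real.pi) := by simp [hT]
    simp only [periodRect, Set.mem_preimage, Set.mem_ofPred_eq, h1, h2, Set.mem_Ioc, Int.cast_zero]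
    constructor <;> rintro ⟨h, h', h''⟩ <;> refine ⟨h, ?_, ?_⟩ <;> linarith
  rw [sphMeasure, withDensity_apply _ (measurableSet_periodRect _ _),
    withDensity_apply _ (measurableSet_periodRect _ _), ← hpre,
    ← (measurePreserving_add_right volume T).setLIntegral_comp_preimage
      (measurableSet_periodRect _ _)
      (f := fun z => ENNReal.ofReal (sphDeriv onePlusExp z ^ 2))
      (continuous_sphDeriv_onePlusExp.measurable.pow_const 2).ennreal_ofReal]
  simp only [hT, sphDeriv_onePlusExp_add_period]

theorem image_onePlusExp_periodStrip : onePlusExp '' periodStrip = {1}ᶜ := by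
  ext w
  simp only [Set.mem_image, Set.mem_compl_iff, Set.mem_singleton_iff, onePlusExp]
  constructor
  · rintro ⟨z, -, rfl⟩
    simp
  · intro hw
    refine ⟨Complex.log (w - 1), ⟨?_, ?_⟩, ?_⟩
    · exact Complex.neg_pi_lt_log_im _
    · exact Complex.log_im_le_pi _
    · rw [Complex.exp_log (sub_ne_zero.2 hw)]
      ring

theorem injOn_onePlusExp_periodStrip : Set.InjOn onePlusExp periodStrip := by
  intro z hz w hw h
  exact Complex.exp_inj_of_neg_pi_lt_of_le_pi hz.1 hz.2 hw.1 hw.2 (add_left_cancel h)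

theorem integral_Ioi_mul_inv_one_add_sq_sq :
    ∫ y in Set.Ioi (0 : ℝ), y * (1 / (1 + y ^ 2)) ^ 2 = 1 / 2 := by
  have hd : ∀ x ∈ Set.Ici (0 : ℝ),
      HasDerivAt (fun y : ℝ => -(1 / 2) * (1 + y ^ 2)⁻¹) (x * (1 / (1 + x ^ 2)) ^ 2) x := by
    intro x _
    have h0 : 1 + x ^ 2 ≠ 0 := by positivity
    convert! ((((hasDerivAt_id x).pow 2).const_add 1).inv h0).const_mul (-(1 / 2) : ℝ) using 1
    simp
    field_simp
  have hl : Tendsto (fun y : ℝ => -(1 / 2) * (1 + y ^ 2)⁻¹) atTop (nhds (-(1 / 2) * 0)) :=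
    (tendsto_inv_atTop_zero.comp
      (tendsto_atTop_add_const_left _ 1 (tendsto_pow_atTop two_ne_zero))).const_mul _
  have hn : ∀ x ∈ Set.Ioi (0 : ℝ), 0 ≤ x * (1 / (1 + x ^ 2)) ^ 2 := fun x hx =>
    mul_nonneg (le_of_lt hx) (by positivity)
  rw [integral_Ioi_of_hasDerivAt_of_nonneg' hd hn hl]
  norm_num

theorem lintegral_sphere_area_form :
    ∫⁻ w : ℂ, ENNReal.ofReal ((1 / (1 + ‖w‖ ^ 2)) ^ 2) = ENNReal.ofReal Real.pi := by
  have hi : Integrable fun w : ℂ => (1 / (1 + ‖w‖ ^ 2)) ^ 2 := by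
    have := integrable_rpow_neg_one_add_norm_sq (E := ℂ) (μ := volume) (r := 4)
      (by simp [Complex.finrank_real_complex]; norm_num)
    refine this.congr (ae_of_all _ fun w => ?_)
    have : (-4 / 2 : ℝ) = -(2 : ℕ) := by norm_num
    simp only [this]
    rw [Real.rpow_neg (by positivity), Real.rpow_natCast, one_div, inv_pow]
  rw [← ofReal_integral_eq_lintegral_ofReal hi (ae_of_all _ fun w => by positivity)]
  have := integral_fun_norm_addHaar (volume : Measure ℂ) fun y : ℝ => (1 / (1 + y ^ 2)) ^ 2
  rw [this]
  simp only [Complex.finrank_real_complex, smul_eq_mul, Nat.add_one_sub_one, pow_one,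
    integral_Ioi_mul_inv_one_add_sq_sq]
  simp only [Measure.real, Complex.volume_ball, ENNReal.ofReal_one, one_pow, one_mul,
    ENNReal.coe_toReal, NNReal.coe_real_pi, nsmul_eq_mul]
  congr 1
  push_cast
  ring

theorem sphMeasure_periodStrip :
    sphMeasure onePlusExp periodStrip = ENNReal.ofReal Real.pi := by
  have hd : ∀ z ∈ periodStrip, HasFDerivWithinAt onePlusExp
      ((ContinuousLinearMap.toSpanSingleton ℂ (Complex.exp z)).restrictScalars ℝ)
      periodStrip z := fun z _ =>
    (((Complex.hasDerivAt_exp z).const_add 1).hasFDerivAt.restrictScalars ℝ).hasFDerivWithinAt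
  have hcompl : ∫⁻ w : ℂ, ENNReal.ofReal ((1 / (1 + ‖w‖ ^ 2)) ^ 2) =
      ∫⁻ w in ({1}ᶜ : Set ℂ), ENNReal.ofReal ((1 / (1 + ‖w‖ ^ 2)) ^ 2) := by
    rw [restrict_compl_singleton]
  rw [sphMeasure, withDensity_apply _ measurableSet_periodStrip, ← lintegral_sphere_area_form,
    hcompl, ← image_onePlusExp_periodStrip,
    lintegral_image_eq_lintegral_abs_det_fderiv_mul volume measurableSet_periodStrip hd
      injOn_onePlusExp_periodStrip]
  refine lintegral_congr fun z => ?_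
  have hdet : ((ContinuousLinearMap.toSpanSingleton ℂ (Complex.exp z)).restrictScalars ℝ).det
      = ‖Complex.exp z‖ ^ 2 := by
    simp [ContinuousLinearMap.det, LinearMap.det_restrictScalars,
      Algebra.norm_complex_eq, Complex.normSq_eq_norm_sq]
  rw [hdet, abs_of_nonneg (by positivity), ← ENNReal.ofReal_mul (by positivity),
    sphDeriv_onePlusExp, onePlusExp]
  congr 1
  ring

theorem tendsto_sphMeasure_periodRect :
    Tendsto (fun R => (sphMeasure onePlusExp (periodRect 0 R)).toReal) atTop
      (nhds Real.pi) := by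
  have hU : ⋃ R, periodRect 0 R = periodStrip := by
    ext z
    simp only [periodRect, periodStrip, Set.mem_iUnion, Set.mem_ofPred_eq]
    constructor
    · rintro ⟨R, -, h⟩
      simpa using h
    · intro h
      exact ⟨|z.re| + 1, by linarith, by simpa using h⟩
  have hm : Monotone fun R => periodRect 0 R := fun R S h z hz => ⟨hz.1.trans_le h, hz.2⟩
  have := tendsto_measure_iUnion_atTop (μ := sphMeasure onePlusExp) hm
  rw [hU, sphMeasure_periodStrip] at this
  have h2 := (ENNReal.tendsto_toReal ENNReal.ofReal_ne_top).comp this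
  rwa [ENNReal.toReal_ofReal Real.pi_pos.le] at h2

theorem sphMeasure_periodRect_le (k : ℤ) (R : ℝ) :
    sphMeasure onePlusExp (periodRect k R) ≤ ENNReal.ofReal Real.pi := by
  rw [sphMeasure_periodRect, ← sphMeasure_periodStrip]
  refine measure_mono fun z hz => ?_
  simpa [periodStrip] using hz.2

theorem ball_subset_iUnion_periodRect {r : ℝ} {N : ℕ} (h : r ≤ (2 * N + 1) * Real.pi) :
    ball (0 : ℂ) r ⊆ ⋃ k ∈ Finset.Icc (-(N : ℤ)) N, periodRect k r := by
  intro z hz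
  have hpi := Real.pi_pos
  have hz : ‖z‖ < r := by simpa using hz
  have him := abs_lt.1 ((Complex.abs_im_le_norm z).trans_lt (hz.trans_le h))
  set k : ℤ := ⌈z.im / (2 * Real.pi) - 1 / 2⌉ with hk
  have h1 : z.im ≤ (2 * k + 1) * Real.pi := by
    have := Int.le_ceil (z.im / (2 * Real.pi) - 1 / 2)
    rw [← hk, sub_le_iff_le_add, div_le_iff₀ (by positivity)] at this
    linarith
  have h2 : (2 * k - 1) * Real.pi < z.im := by
    have := Int.ceil_lt_add_one (z.im / (2 * Real.pi) - 1 / 2)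
    rw [← hk, ← sub_lt_iff_lt_add, lt_sub_iff_add_lt, lt_div_iff₀ (by positivity)] at this
    linarith
  simp only [Set.mem_iUnion, Finset.mem_Icc]
  refine ⟨k, ⟨?_, ?_⟩, (Complex.abs_re_le_norm z).trans_lt hz, h2, h1⟩
  · have h3 : -(2 * N + 1 : ℝ) < 2 * k + 1 := by
      refine lt_of_mul_lt_mul_right (a := Real.pi) ?_ hpi.le
      linarith [him.1]
    have h4 : -(2 * N + 1 : ℤ) < 2 * k + 1 := by exact_mod_cast h3
    omega
  · have h3 : (2 * k - 1 : ℝ) < 2 * N + 1 := by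
      refine lt_of_mul_lt_mul_right (a := Real.pi) ?_ hpi.le
      linarith [him.2]
    have h4 : 2 * k - 1 < (2 * N + 1 : ℤ) := by exact_mod_cast h3
    omega

theorem card_Icc_neg_natCast (N : ℕ) : (Finset.Icc (-(N : ℤ)) N).card = 2 * N + 1 := by
  rw [Int.card_Icc]
  omega

theorem sphMeasure_ball_le {r : ℝ} {N : ℕ} (h : r ≤ (2 * N + 1) * Real.pi) :
    sphMeasure onePlusExp (ball 0 r) ≤ ENNReal.ofReal ((2 * N + 1) * Real.pi) := by
  calc sphMeasure onePlusExp (ball 0 r)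
      ≤ sphMeasure onePlusExp (⋃ k ∈ Finset.Icc (-(N : ℤ)) N, periodRect k r) :=
        measure_mono (ball_subset_iUnion_periodRect h)
    _ ≤ ∑ k ∈ Finset.Icc (-(N : ℤ)) N, sphMeasure onePlusExp (periodRect k r) :=
        measure_biUnion_finset_le _ _
    _ ≤ ∑ k ∈ Finset.Icc (-(N : ℤ)) N, ENNReal.ofReal Real.pi :=
        Finset.sum_le_sum fun k _ => sphMeasure_periodRect_le k r
    _ = ENNReal.ofReal ((2 * N + 1) * Real.pi) := by
        rw [Finset.sum_const, card_Icc_neg_natCast, ← ENNReal.ofReal_nsmul, nsmul_eq_mul]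
        push_cast
        rfl

theorem exists_nat_le_odd_mul_pi (r : ℝ) : ∃ N : ℕ, r ≤ (2 * N + 1) * Real.pi := by
  obtain ⟨N, hN⟩ := exists_nat_ge (r / Real.pi)
  rw [div_le_iff₀ Real.pi_pos] at hN
  exact ⟨N, hN.trans (mul_le_mul_of_nonneg_right
    (by linarith [N.cast_nonneg (α := ℝ)]) Real.pi_pos.le)⟩

theorem sphMeasure_ball_ne_top (r : ℝ) : sphMeasure onePlusExp (ball 0 r) ≠ ⊤ :=
  have ⟨_, hN⟩ := exists_nat_le_odd_mul_pi r
  ((sphMeasure_ball_le hN).trans_lt ENNReal.ofReal_lt_top).ne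

theorem pairwiseDisjoint_periodRect (s : Set ℤ) (R : ℝ) :
    s.PairwiseDisjoint fun k => periodRect k R := by
  intro k _ l _ hkl
  refine Set.disjoint_left.2 fun z hk hl => hkl ?_
  have key : ∀ {a b : ℤ}, z ∈ periodRect a R → z ∈ periodRect b R → a ≤ b := by
    intro a b ha hb
    have h3 : (2 * a - 1 : ℝ) < 2 * b + 1 :=
      lt_of_mul_lt_mul_right (ha.2.1.trans_le hb.2.2) Real.pi_pos.le
    have h4 : 2 * a - 1 < 2 * b + 1 := by exact_mod_cast h3
    omega
  exact le_antisymm (key hk hl) (key hl hk)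

theorem periodRect_subset_ball {r R : ℝ} {N : ℕ} {k : ℤ} (hk : k ∈ Finset.Icc (-(N : ℤ)) N)
    (hN : (2 * N + 1) * Real.pi ≤ r - 1) (hR : R ^ 2 ≤ 2 * r - 2) :
    periodRect k R ⊆ ball 0 r := by
  intro z hz
  have hpi := Real.pi_pos
  have hN0 : 0 ≤ (2 * N + 1) * Real.pi := by positivity
  obtain ⟨hk1, hk2⟩ := Finset.mem_Icc.1 hk
  have h1 : -(N : ℝ) ≤ k := by exact_mod_cast hk1
  have h2 : (k : ℝ) ≤ N := by exact_mod_cast hk2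
  have him : |z.im| ≤ r - 1 := abs_le.2 ⟨by nlinarith [hz.2.1], by nlinarith [hz.2.2]⟩
  have him2 : z.im ^ 2 ≤ (r - 1) ^ 2 := sq_le_sq.2 (him.trans (le_abs_self _))
  have hre2 : z.re ^ 2 < R ^ 2 := sq_lt_sq.2 (hz.1.trans_le (le_abs_self _))
  rw [mem_ball_zero_iff]
  refine lt_of_pow_lt_pow_left₀ 2 (by linarith) ?_
  rw [← Complex.normSq_eq_norm_sq, Complex.normSq_apply]
  nlinarith

theorem le_sphMeasure_ball {r R : ℝ} {N : ℕ} (hN : (2 * N + 1) * Real.pi ≤ r - 1)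
    (hR : R ^ 2 ≤ 2 * r - 2) :
    (2 * N + 1) * (sphMeasure onePlusExp (periodRect 0 R)).toReal ≤
      (sphMeasure onePlusExp (ball 0 r)).toReal := by
  have h : ∑ k ∈ Finset.Icc (-(N : ℤ)) N, sphMeasure onePlusExp (periodRect k R) ≤
      sphMeasure onePlusExp (ball 0 r) := by
    rw [← measure_biUnion_finset (pairwiseDisjoint_periodRect _ R)
      fun k _ => measurableSet_periodRect k R]
    exact measure_mono (Set.iUnion₂_subset fun k hk => periodRect_subset_ball hk hN hR)
  have h' := ENNReal.toReal_mono (sphMeasure_ball_ne_top r) h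
  rw [Finset.sum_congr rfl fun k _ => sphMeasure_periodRect k R, Finset.sum_const,
    card_Icc_neg_natCast, ENNReal.toReal_nsmul, nsmul_eq_mul] at h'
  exact_mod_cast h'

theorem sphArea_onePlusExp_le {r : ℝ} (hr : 0 ≤ r) : sphArea onePlusExp r ≤ r / Real.pi + 3 := by
  have hpi := Real.pi_pos
  set N := ⌈r / (2 * Real.pi)⌉₊ with hN
  have h1 : r ≤ (2 * N + 1) * Real.pi := by
    have := Nat.le_ceil (r / (2 * Real.pi))
    rw [← hN, div_le_iff₀ (by positivity)] at this
    linarith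
  have h2 : (2 * N + 1 : ℝ) ≤ r / Real.pi + 3 := by
    have := Nat.ceil_lt_add_one (a := r / (2 * Real.pi)) (by positivity)
    rw [← hN] at this
    have h3 : r / Real.pi = 2 * (r / (2 * Real.pi)) := by field_simp
    linarith
  refine le_trans ?_ h2
  rw [sphArea_onePlusExp, one_div, inv_mul_le_iff₀ hpi, mul_comm Real.pi]
  exact ENNReal.toReal_le_of_le_ofReal (by positivity) (sphMeasure_ball_le h1)

theorem le_sphArea_onePlusExp {r : ℝ} (hr : Real.pi + 1 ≤ r) :
    ((r - 1) / Real.pi - 2) *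
      ((sphMeasure onePlusExp (periodRect 0 √(2 * r - 2))).toReal / Real.pi) ≤
      sphArea onePlusExp r := by
  have hpi := Real.pi_pos
  set x := ((r - 1) / Real.pi - 1) / 2 with hx
  set N := ⌊x⌋₊ with hN
  have h0 : 0 ≤ x := by
    have : 1 ≤ (r - 1) / Real.pi := by rw [le_div_iff₀ hpi]; linarith
    linarith
  have h1 : (2 * N + 1) * Real.pi ≤ r - 1 := by
    have := Nat.floor_le h0
    rw [← le_div_iff₀ hpi]
    linarith
  have h2 : (r - 1) / Real.pi - 2 ≤ 2 * N + 1 := by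
    have := Nat.lt_floor_add_one x
    linarith
  have hR : √(2 * r - 2) ^ 2 ≤ 2 * r - 2 := (Real.sq_sqrt (by linarith)).le
  calc _ ≤ (2 * N + 1) *
      ((sphMeasure onePlusExp (periodRect 0 √(2 * r - 2))).toReal / Real.pi) :=
        mul_le_mul_of_nonneg_right h2 (by positivity)
    _ = 1 / Real.pi *
      ((2 * N + 1) * (sphMeasure onePlusExp (periodRect 0 √(2 * r - 2))).toReal) := by ring
    _ ≤ _ := by
      rw [sphArea_onePlusExp]
      exact mul_le_mul_of_nonneg_left (le_sphMeasure_ball h1 hR) (by positivity)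

theorem tendsto_sphArea_onePlusExp_div :
    Tendsto (fun r => sphArea onePlusExp r / r) atTop (nhds (1 / Real.pi)) := by
  have hpi := Real.pi_pos
  have hsq : Tendsto (fun r : ℝ => √(2 * r - 2)) atTop atTop :=
    Real.tendsto_sqrt_atTop.comp
      (tendsto_atTop_add_const_right _ (-2) (tendsto_id.const_mul_atTop two_pos))
  have hm : Tendsto (fun r : ℝ =>
      (sphMeasure onePlusExp (periodRect 0 √(2 * r - 2))).toReal / Real.pi) atTop (nhds 1) := by
    simpa [hpi.ne'] using (tendsto_sphMeasure_periodRect.comp hsq).div_const Real.pi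
  have hlow : Tendsto (fun r : ℝ => (1 / Real.pi - (1 / Real.pi + 2) * r⁻¹) *
      ((sphMeasure onePlusExp (periodRect 0 √(2 * r - 2))).toReal / Real.pi)) atTop
      (nhds (1 / Real.pi)) := by
    simpa using ((tendsto_inv_atTop_zero.const_mul (1 / Real.pi + 2)).const_sub
      (1 / Real.pi)).mul hm
  have hup : Tendsto (fun r : ℝ => 1 / Real.pi + 3 * r⁻¹) atTop (nhds (1 / Real.pi)) := by
    simpa using (tendsto_inv_atTop_zero.const_mul (3 : ℝ)).const_add (1 / Real.pi)
  refine tendsto_of_tendsto_of_tendsto_of_le_of_le' hlow hup ?_ ?_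
  · filter_upwards [eventually_ge_atTop (Real.pi + 1)] with r hr
    have hr0 : 0 < r := by linarith
    rw [le_div_iff₀ hr0]
    refine le_trans (le_of_eq ?_) (le_sphArea_onePlusExp hr)
    field_simp
    ring
  · filter_upwards [eventually_gt_atTop 0] with r hr
    rw [div_le_iff₀ hr]
    refine (sphArea_onePlusExp_le hr.le).trans (le_of_eq ?_)
    field_simp

theorem sphArea_onePlusExp_nonneg (r : ℝ) : 0 ≤ sphArea onePlusExp r := by
  rw [sphArea_onePlusExp]
  positivity

theorem sphArea_onePlusExp_le_sq {r : ℝ} (hr : 0 ≤ r) : sphArea onePlusExp r ≤ 4 * r ^ 2 := by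
  have hpi := Real.pi_pos
  rw [sphArea_onePlusExp, one_div, inv_mul_le_iff₀ hpi]
  refine ENNReal.toReal_le_of_le_ofReal (by positivity) ?_
  rw [sphMeasure, withDensity_apply _ measurableSet_ball]
  calc _ ≤ ∫⁻ _ in ball (0 : ℂ) r, ENNReal.ofReal 4 := by
        refine lintegral_mono fun z => ENNReal.ofReal_le_ofReal ?_
        nlinarith [sphDeriv_onePlusExp_nonneg z, sphDeriv_onePlusExp_le z]
    _ = _ := by
        rw [setLIntegral_const, Complex.volume_ball, ← ENNReal.ofReal_pow hr,
          ← NNReal.coe_real_pi, ENNReal.ofReal_mul (by positivity), ENNReal.ofReal_coe_nnreal,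
          ENNReal.ofReal_mul (by positivity)]
        ring

theorem monotone_sphArea_onePlusExp : Monotone (sphArea onePlusExp) := by
  intro r s h
  rw [sphArea_onePlusExp, sphArea_onePlusExp]
  refine mul_le_mul_of_nonneg_left ?_ (by positivity)
  exact ENNReal.toReal_mono (sphMeasure_ball_ne_top s) (measure_mono (ball_subset_ball h))

theorem intervalIntegrable_sphArea_div {a b : ℝ} (ha : 0 ≤ a) (hab : a ≤ b) :
    IntervalIntegrable (fun t => sphArea onePlusExp t / t) volume a b := by
  refine IntervalIntegrable.mono_fun' (g := fun t => 4 * t)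
    ((continuous_const.mul continuous_id).intervalIntegrable _ _)
    (monotone_sphArea_onePlusExp.measurable.div measurable_id).aestronglyMeasurable ?_
  rw [Set.uIoc_of_le hab]
  filter_upwards [ae_restrict_mem measurableSet_Ioc] with t ht
  have ht0 : 0 < t := ha.trans_lt ht.1
  rw [Real.norm_of_nonneg (div_nonneg (sphArea_onePlusExp_nonneg t) ht0.le), div_le_iff₀ ht0]
  linarith [sphArea_onePlusExp_le_sq ht0.le]

/-- Continuous Cesàro means: a locally integrable function with a limit at infinity has the same
limit in average. -/
theorem tendsto_integral_div_of_tendsto {h : ℝ → ℝ} {L : ℝ}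
    (hi : ∀ a b, 0 ≤ a → a ≤ b → IntervalIntegrable h volume a b)
    (hl : Tendsto h atTop (nhds L)) :
    Tendsto (fun r => (∫ t in (0 : ℝ)..r, h t) / r) atTop (nhds L) := by
  rw [Metric.tendsto_atTop]
  intro ε hε
  obtain ⟨r₀, hr₀⟩ := Metric.tendsto_atTop.1 hl (ε / 2) (by positivity)
  set a := max r₀ 0 with ha
  have ha0 : 0 ≤ a := le_max_right _ _
  set C := |(∫ t in (0 : ℝ)..a, h t) - L * a| with hC
  have hC0 : 0 ≤ C := abs_nonneg _
  refine ⟨a + 2 * C / ε + 1, fun r hr => ?_⟩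
  have hq : 0 ≤ 2 * C / ε := by positivity
  have har : a ≤ r := by linarith
  have hr0 : 0 < r := by linarith
  have hsplit : (∫ t in (0 : ℝ)..r, h t) - L * r =
      ((∫ t in (0 : ℝ)..a, h t) - L * a) + ∫ t in a..r, (h t - L) := by
    rw [intervalIntegral.integral_sub (hi a r ha0 har) (by simp), intervalIntegral.integral_const,
      ← intervalIntegral.integral_add_adjacent_intervals (hi 0 a le_rfl ha0) (hi a r ha0 har),
      smul_eq_mul]
    ring
  have htail : ‖∫ t in a..r, (h t - L)‖ ≤ ε / 2 * |r - a| := by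
    refine intervalIntegral.norm_integral_le_of_norm_le_const fun t ht => ?_
    rw [Set.uIoc_of_le har] at ht
    exact (hr₀ t ((le_max_left _ _).trans ht.1.le)).le
  rw [Real.norm_eq_abs, abs_of_nonneg (sub_nonneg.2 har)] at htail
  have hsmall : C < ε / 2 * r := by
    have : 2 * C / ε < r := by linarith
    rw [div_lt_iff₀ hε] at this
    linarith
  have hrw : (∫ t in (0 : ℝ)..r, h t) / r - L = ((∫ t in (0 : ℝ)..r, h t) - L * r) / r := by
    field_simp
  rw [Real.dist_eq, hrw, abs_div, abs_of_pos hr0, div_lt_iff₀ hr0, hsplit]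
  refine (abs_add_le _ _).trans_lt ?_
  nlinarith

theorem tendsto_nevT_onePlusExp_div :
    Tendsto (fun r => nevT onePlusExp r / r) atTop (nhds (1 / Real.pi)) :=
  tendsto_integral_div_of_tendsto (fun _ _ => intervalIntegrable_sphArea_div)
    tendsto_sphArea_onePlusExp_div

theorem logPlus_onePlusExp (z : ℂ) :
    logPlus (1 / ‖onePlusExp z - 1‖) = max (-z.re) 0 := by
  rw [logPlus, onePlusExp, add_sub_cancel_left, one_div, Real.log_inv, Complex.norm_exp,
    Real.log_exp]

theorem Lfin_onePlusExp {r : ℝ} (hr : 0 ≤ r) : Lfin onePlusExp 1 r = r := by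
  simp only [Lfin, logPlus_onePlusExp]
  refine IsGreatest.csSup_eq ⟨⟨-r, ?_, ?_⟩, ?_⟩
  · simp [abs_of_nonneg hr]
  · simp [hr]
  · rintro _ ⟨z, hz, rfl⟩
    have hz : ‖z‖ = r := by simpa using hz
    exact max_le (((neg_le_abs _).trans (Complex.abs_re_le_norm z)).trans hz.le) hr

theorem integral_max_neg_cos :
    ∫ θ in (0 : ℝ)..(2 * Real.pi), max (-Real.cos θ) 0 = 2 := by
  have hpi := Real.pi_pos
  have hcont : Continuous fun θ => max (-Real.cos θ) 0 := by fun_prop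
  have hper : Function.Periodic (fun θ => max (-Real.cos θ) 0) (2 * Real.pi) := fun θ => by
    simp [Real.cos_add_two_pi]
  have h := hper.intervalIntegral_add_eq 0 (-(Real.pi / 2))
  rw [zero_add] at h
  rw [h, ← intervalIntegral.integral_add_adjacent_intervals (b := Real.pi / 2)
    (hcont.intervalIntegrable _ _) (hcont.intervalIntegrable _ _)]
  have h1 : ∫ θ in (-(Real.pi / 2))..(Real.pi / 2), max (-Real.cos θ) 0 = 0 := by
    refine (intervalIntegral.integral_congr (g := fun _ => 0) fun θ hθ => ?_).trans (by simp)
    rw [Set.uIcc_of_le (by linarith)] at hθ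
    exact max_eq_right (neg_nonpos.2 (Real.cos_nonneg_of_mem_Icc hθ))
  have h2 : ∫ θ in (Real.pi / 2)..(-(Real.pi / 2) + 2 * Real.pi), max (-Real.cos θ) 0 = 2 := by
    refine (intervalIntegral.integral_congr (g := fun θ => -Real.cos θ) fun θ hθ => ?_).trans ?_
    · rw [Set.uIcc_of_le (by linarith)] at hθ
      exact max_eq_left (neg_nonneg.2
        (Real.cos_nonpos_of_pi_div_two_le_of_le hθ.1 (by linarith [hθ.2])))
    · rw [intervalIntegral.integral_neg, integral_cos, Real.sin_add_two_pi, Real.sin_neg,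
        Real.sin_pi_div_two]
      norm_num
  rw [h1, h2, zero_add]

theorem proximity_onePlusExp {r : ℝ} (hr : 0 ≤ r) : proximity onePlusExp 1 r = r / Real.pi := by
  have hpt : ∀ θ : ℝ, max (-(circlePt r θ).re) 0 = r * max (-Real.cos θ) 0 := fun θ => by
    rw [mul_max_of_nonneg _ _ hr, mul_zero, circlePt, Complex.re_ofReal_mul,
      Complex.exp_ofReal_mul_I_re, mul_neg]
  simp only [proximity, logPlus_onePlusExp, hpt, intervalIntegral.integral_const_mul,
    integral_max_neg_cos]
  field_simp

theorem deltaN_onePlusExp : deltaN onePlusExp 1 = 1 := by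
  refine Tendsto.liminf_eq ?_
  have h := (tendsto_nevT_onePlusExp_div.inv₀ (by positivity)).const_mul (1 / Real.pi)
  rw [mul_inv_cancel₀ (by positivity)] at h
  refine h.congr' ?_
  filter_upwards [eventually_ge_atTop 0] with r hr
  rw [proximity_onePlusExp hr, inv_div]
  ring

theorem deltaP_onePlusExp : deltaP onePlusExp 1 = Real.pi := by
  refine Tendsto.liminf_eq ?_
  have h := tendsto_nevT_onePlusExp_div.inv₀ (by positivity)
  rw [one_div, inv_inv] at h
  refine h.congr' ?_
  filter_upwards [eventually_ge_atTop 0] with r hr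
  rw [Lfin_onePlusExp hr, inv_div]

theorem hasDerivAt_exp_add_exp_neg (z : ℂ) :
    HasDerivAt (fun w => Complex.exp (w + Complex.exp (-w)))
      ((1 - Complex.exp (-z)) * Complex.exp (z + Complex.exp (-z))) z := by
  convert! ((hasDerivAt_id z).add (hasDerivAt_id z).neg.cexp).cexp using 1
  simp
  ring

theorem linearIndependent_frei_solutions :
    LinearIndependent ℂ
      ![(fun w => 1 + Complex.exp w : ℂ → ℂ),
        (fun w => Complex.exp (w + Complex.exp (-w)) : ℂ → ℂ)] := by
  rw [LinearIndependent.pair_iff]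
  intro s t h
  have ht : t = 0 := by
    have := congrFun h (Real.pi * Complex.I)
    simpa [Complex.exp_pi_mul_I, Complex.exp_ne_zero] using this
  subst ht
  have := congrFun h 0
  norm_num at this
  exact ⟨this, rfl⟩

/-- Example 1.6, Frei: `f₁ = 1 + eᶻ` and `f₂ = exp(z + e^{−z})` are linearly
independent solutions of `f'' + e^{−z} f' − f = 0`, with `δ_N(1,f₁) = 1` and `δ_P(1,f₁) = π`. -/
theorem frei_example :
    (∀ z : ℂ, iteratedDeriv 2 (fun w => 1 + Complex.exp w) z
        + Complex.exp (-z) * deriv (fun w => 1 + Complex.exp w) z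
        - (1 + Complex.exp z) = 0) ∧
    (∀ z : ℂ, iteratedDeriv 2 (fun w => Complex.exp (w + Complex.exp (-w))) z
        + Complex.exp (-z) * deriv (fun w => Complex.exp (w + Complex.exp (-w))) z
        - Complex.exp (z + Complex.exp (-z)) = 0) ∧
    LinearIndependent ℂ
      ![(fun w => 1 + Complex.exp w : ℂ → ℂ),
        (fun w => Complex.exp (w + Complex.exp (-w)) : ℂ → ℂ)] ∧
    deltaN (fun w => 1 + Complex.exp w) 1 = 1 ∧
    deltaP (fun w => 1 + Complex.exp w) 1 = Real.pi := by
  refine ⟨fun z => ?_, fun z => ?_, linearIndependent_frei_solutions, deltaN_onePlusExp,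
    deltaP_onePlusExp⟩
  · have hd : deriv (fun w => 1 + Complex.exp w) = Complex.exp := deriv_onePlusExp
    rw [iteratedDeriv_succ, iteratedDeriv_one, hd, Complex.deriv_exp, ← Complex.exp_add]
    simp
    ring
  · have hd : deriv (fun w => Complex.exp (w + Complex.exp (-w))) =
        fun w => (1 - Complex.exp (-w)) * Complex.exp (w + Complex.exp (-w)) :=
      funext fun w => (hasDerivAt_exp_add_exp_neg w).deriv
    have hd2 := (((hasDerivAt_id z).neg.cexp.const_sub 1).mul (hasDerivAt_exp_add_exp_neg z)).deriv
    rw [iteratedDeriv_succ, iteratedDeriv_one, hd]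
    refine (congrArg (fun x => x + _ - _) hd2).trans ?_
    simp
    ring
end
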